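/- arXiv:1102.4552 — 6 statements merged into one kernel-verified Lean document; each statement's English description precedes it below -/
import Mathlib

section
/- Let p ≥ 5 be a prime with p ≡ 1 (mod 3), and let e ≥ 1. Then the number Θ(p^e) of equivalence classes of 𝔉_{p^e} under the relation ~ satisfies 72·Θ(p^e) = p^{4e} − 10p^{4e−1} + 35p^{4e−2} − 50p^{4e−3} + 24p^{4e−4} + 10p^{2e} − 68p^{2e−1} + 106p^{2e−2} + 24. -/
open Matrix

/-- `𝔉ₙ`: matrices `A = [[a,b],[c,d]]` over `ℤ/nℤ` with unit determinant `ad - bc` and with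
`a, b, c, d, a+b, c+d, a-c, b-d, a+b-c-d` all units of `ℤ/nℤ`. -/
def Frak (n : ℕ) (A : Matrix (Fin 2) (Fin 2) (ZMod n)) : Prop :=
  IsUnit (A 0 0 * A 1 1 - A 0 1 * A 1 0) ∧
  IsUnit (A 0 0) ∧ IsUnit (A 0 1) ∧ IsUnit (A 1 0) ∧ IsUnit (A 1 1) ∧
  IsUnit (A 0 0 + A 0 1) ∧ IsUnit (A 1 0 + A 1 1) ∧
  IsUnit (A 0 0 - A 1 0) ∧ IsUnit (A 0 1 - A 1 1) ∧
  IsUnit (A 0 0 + A 0 1 - A 1 0 - A 1 1)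

/-- The matrix `M₁ = [[-1,1],[-1,0]]` as an element of `GL₂(ℤ/nℤ)`. -/
noncomputable def M1 (n : ℕ) : GL (Fin 2) (ZMod n) :=
  Matrix.nonsingInvUnit !![-1, 1; -1, 0] (by simp [Matrix.det_fin_two_of])

/-- The matrix `M₂ = [[0,1],[1,0]]` as an element of `GL₂(ℤ/nℤ)`. -/
noncomputable def M2 (n : ℕ) : GL (Fin 2) (ZMod n) :=
  Matrix.nonsingInvUnit !![0, 1; 1, 0] (by simp [Matrix.det_fin_two_of])

/-- The copy of `S₃` inside `GL₂(ℤ/nℤ)` generated by `M₁` and `M₂`. -/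
noncomputable def Sgrp (n : ℕ) : Subgroup (GL (Fin 2) (ZMod n)) :=
  Subgroup.closure {M1 n, M2 n}

/-- The relation `A ~ B` on matrices over `ℤ/nℤ`: `B = Q·A·P` or `B = Q·A⁻¹·P`
for some `P, Q` in the copy `S` of `S₃`. -/
noncomputable def BRel (n : ℕ) (A B : Matrix (Fin 2) (Fin 2) (ZMod n)) : Prop :=
  ∃ P Q : GL (Fin 2) (ZMod n), P ∈ Sgrp n ∧ Q ∈ Sgrp n ∧
    (B = (Q : Matrix (Fin 2) (Fin 2) (ZMod n)) * A * (P : Matrix (Fin 2) (Fin 2) (ZMod n)) ∨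
     B = (Q : Matrix (Fin 2) (Fin 2) (ZMod n)) * A⁻¹ * (P : Matrix (Fin 2) (Fin 2) (ZMod n)))

/-- `Θ(n)`: the number of equivalence classes of `𝔉ₙ` under `~`. -/
noncomputable def Theta (n : ℕ) : ℕ :=
  Nat.card (Quot (fun A B : {A : Matrix (Fin 2) (Fin 2) (ZMod n) // Frak n A} => BRel n A.1 B.1))

/-- The matrices of the elements of `S₃` in its two-dimensional integral representation. -/
def s3Mat : DihedralGroup 3 → Matrix (Fin 2) (Fin 2) ℤ
  | .r i => ![1, !![-1, 1; -1, 0], !![0, -1; 1, -1]] i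
  | .sr i => ![!![0, 1; 1, 0], !![-1, 0; -1, 1], !![1, -1; 0, -1]] i

/-- The two-dimensional integral representation of `S₃`, generated by `M₁` and `M₂`. -/
def s3IntRep : DihedralGroup 3 →* Matrix (Fin 2) (Fin 2) ℤ where
  toFun := s3Mat
  map_one' := rfl
  map_mul' := by decide

/-- The representation of `S₃` over `R` obtained from `s3IntRep` by base change. -/
def s3Rep (R : Type*) [CommRing R] : DihedralGroup 3 →* Matrix (Fin 2) (Fin 2) R :=
  ((Int.castRingHom R).mapMatrix.toMonoidHom).comp s3IntRep

section
variable {R : Type*} [CommRing R]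

lemma s3Rep_apply (g) : s3Rep R g = (s3Mat g).map (Int.cast : ℤ → R) := rfl

lemma s3Rep_r_zero : s3Rep R (.r 0) = 1 := map_one _

lemma s3Rep_r_one : s3Rep R (.r 1) = !![-1, 1; -1, 0] := by
  ext i j; fin_cases i <;> fin_cases j <;> simp [s3Rep_apply, s3Mat]

lemma s3Rep_r_two : s3Rep R (.r 2) = !![0, -1; 1, -1] := by
  ext i j; fin_cases i <;> fin_cases j <;> simp [s3Rep_apply, s3Mat]

lemma s3Rep_sr_zero : s3Rep R (.sr 0) = !![0, 1; 1, 0] := by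
  ext i j; fin_cases i <;> fin_cases j <;> simp [s3Rep_apply, s3Mat]

lemma s3Rep_sr_one : s3Rep R (.sr 1) = !![-1, 0; -1, 1] := by
  ext i j; fin_cases i <;> fin_cases j <;> simp [s3Rep_apply, s3Mat]

lemma s3Rep_sr_two : s3Rep R (.sr 2) = !![1, -1; 0, -1] := by
  ext i j; fin_cases i <;> fin_cases j <;> simp [s3Rep_apply, s3Mat]

lemma s3_cases (P : DihedralGroup 3 → Prop) (h0 : P (.r 0)) (h1 : P (.r 1)) (h2 : P (.r 2))
    (k0 : P (.sr 0)) (k1 : P (.sr 1)) (k2 : P (.sr 2)) (g) : P g := by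
  rcases g with i | i <;> fin_cases i <;> assumption

lemma s3_sum {M : Type*} [AddCommMonoid M] (f : DihedralGroup 3 → M) :
    ∑ g, f g = f (.r 0) + f (.r 1) + f (.r 2) + (f (.sr 0) + f (.sr 1) + f (.sr 2)) := by
  have h : (Finset.univ : Finset (DihedralGroup 3)) =
    {.r 0, .r 1, .r 2, .sr 0, .sr 1, .sr 2} := by decide
  rw [h]
  repeat rw [Finset.sum_insert (by decide)]
  rw [Finset.sum_singleton]
  abel

/-- The product of all the entries required to be units in `Frak`. -/
def frakProd (A : Matrix (Fin 2) (Fin 2) R) : R :=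
  (A 0 0 * A 1 1 - A 0 1 * A 1 0) * (A 0 0 * A 0 1 * A 1 0 * A 1 1) *
    ((A 0 0 + A 0 1) * (A 1 0 + A 1 1) * (A 0 0 - A 1 0) * (A 0 1 - A 1 1)) *
      (A 0 0 + A 0 1 - A 1 0 - A 1 1)

lemma frak_iff {n : ℕ} (A : Matrix (Fin 2) (Fin 2) (ZMod n)) :
    Frak n A ↔ IsUnit (frakProd A) := by
  simp only [Frak, frakProd, IsUnit.mul_iff, and_assoc]

lemma frakProd_map {S : Type*} [CommRing S] (f : R →+* S) (A : Matrix (Fin 2) (Fin 2) R) :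
    frakProd (f.mapMatrix A) = f (frakProd A) := by
  simp [frakProd]

lemma isUnit_frakProd_s3Rep_mul (g : DihedralGroup 3) {A : Matrix (Fin 2) (Fin 2) R}
    (h : IsUnit (frakProd A)) : IsUnit (frakProd (s3Rep R g * A)) := by
  suffices frakProd (s3Rep R g * A) = frakProd A by rwa [this]
  induction g using s3_cases with
  | h0 => simp
  | h1 => simp [s3Rep_r_one, frakProd, mul_apply]; ring
  | h2 => simp [s3Rep_r_two, frakProd, mul_apply]; ring
  | k0 => simp [s3Rep_sr_zero, frakProd, mul_apply]; ring
  | k1 => simp [s3Rep_sr_one, frakProd, mul_apply]; ring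
  | k2 => simp [s3Rep_sr_two, frakProd, mul_apply]; ring

lemma isUnit_frakProd_mul_s3Rep (g : DihedralGroup 3) {A : Matrix (Fin 2) (Fin 2) R}
    (h : IsUnit (frakProd A)) : IsUnit (frakProd (A * s3Rep R g)) := by
  suffices frakProd (A * s3Rep R g) = frakProd A ∨ frakProd (A * s3Rep R g) = - frakProd A by
    rcases this with h' | h' <;> simpa [h'] using h
  induction g using s3_cases with
  | h0 => simp
  | h1 => left; simp [s3Rep_r_one, frakProd, mul_apply]; ring
  | h2 => left; simp [s3Rep_r_two, frakProd, mul_apply]; ring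
  | k0 => right; simp [s3Rep_sr_zero, frakProd, mul_apply]; ring
  | k1 => right; simp [s3Rep_sr_one, frakProd, mul_apply]; ring
  | k2 => right; simp [s3Rep_sr_two, frakProd, mul_apply]; ring

lemma isUnit_det_of_frakProd {A : Matrix (Fin 2) (Fin 2) R} (h : IsUnit (frakProd A)) :
    IsUnit A.det := by
  simp only [frakProd, IsUnit.mul_iff] at h
  simpa [det_fin_two] using h.1.1.1

lemma isUnit_frakProd_inv {A : Matrix (Fin 2) (Fin 2) R} (h : IsUnit (frakProd A)) :
    IsUnit (frakProd A⁻¹) := by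
  have hd := isUnit_det_of_frakProd h
  have hu : IsUnit (Ring.inverse A.det) := hd.ringInverse
  suffices frakProd A⁻¹ = - (frakProd A * (Ring.inverse A.det) ^ 11) by
    simpa [this] using h.mul (hu.pow 11)
  rw [inv_def, adjugate_fin_two]
  simp only [frakProd, Matrix.smul_apply, of_apply, cons_val', cons_val_zero, cons_val_one,
    cons_val_fin_one, smul_eq_mul]
  ring

lemma s3Rep_mul_inv_cancel (g : DihedralGroup 3) : s3Rep R g * s3Rep R g⁻¹ = 1 := by
  rw [← map_mul, mul_inv_cancel, map_one]

lemma s3Rep_inv_mul_cancel (g : DihedralGroup 3) : s3Rep R g⁻¹ * s3Rep R g = 1 := by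
  rw [← map_mul, inv_mul_cancel, map_one]

lemma inv_s3Rep (g : DihedralGroup 3) : (s3Rep R g)⁻¹ = s3Rep R g⁻¹ :=
  inv_eq_right_inv (s3Rep_mul_inv_cancel g)

lemma trace_eq_of_intertwine {A P Q : Matrix (Fin 2) (Fin 2) R} (hA : IsUnit A.det)
    (h : Q * A = A * P) : Q.trace = P.trace := by
  have : Q = A * P * A⁻¹ := by rw [← h, mul_nonsing_inv_cancel_right _ _ hA]
  rw [this, trace_mul_cycle, nonsing_inv_mul _ hA, one_mul]

lemma frakProd_eq_zero_of_reflections (i j : ZMod 3) {A : Matrix (Fin 2) (Fin 2) R}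
    (h : s3Rep R (.sr i) * A = A * s3Rep R (.sr j)) : frakProd A = 0 := by
  suffices A 0 0 = 0 ∨ A 0 1 = 0 ∨ A 1 0 = 0 ∨ A 1 1 = 0 ∨ A 0 0 + A 0 1 = 0 ∨
      A 1 0 + A 1 1 = 0 ∨ A 0 0 - A 1 0 = 0 ∨ A 0 1 - A 1 1 = 0 ∨
      A 0 0 + A 0 1 - A 1 0 - A 1 1 = 0 by
    rcases this with h | h | h | h | h | h | h | h | h <;> simp [frakProd, h]
  have h00 := congrFun₂ h 0 0
  have h01 := congrFun₂ h 0 1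
  have h10 := congrFun₂ h 1 0
  have h11 := congrFun₂ h 1 1
  clear h
  have h3 : ∀ i : ZMod 3, i = 0 ∨ i = 1 ∨ i = 2 := by decide
  rcases h3 i with rfl | rfl | rfl <;> rcases h3 j with rfl | rfl | rfl <;>
    simp [s3Rep_sr_zero, s3Rep_sr_one, s3Rep_sr_two, mul_apply] at h00 h01 h10 h11
  all_goals grind

end

lemma sgrp_eq_range (n : ℕ) : Sgrp n = (s3Rep (ZMod n)).toHomUnits.range := by
  have h1 : (s3Rep (ZMod n)).toHomUnits (.r 1) = M1 n := by
    ext1; simp [s3Rep_r_one, M1, nonsingInvUnit]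
  have h2 : (s3Rep (ZMod n)).toHomUnits (.sr 0) = M2 n := by
    ext1; simp [s3Rep_sr_zero, M2, nonsingInvUnit]
  apply le_antisymm
  · rw [Sgrp, Subgroup.closure_le]
    rintro x (rfl | rfl)
    exacts [⟨_, h1⟩, ⟨_, h2⟩]
  · rintro _ ⟨g, rfl⟩
    have hg : ∀ g : DihedralGroup 3, ∃ i : Fin 2, ∃ j : Fin 3,
      g = .sr 0 ^ (i : ℕ) * .r 1 ^ (j : ℕ) := by decide
    obtain ⟨i, j, rfl⟩ := hg g
    rw [map_mul, map_pow, map_pow, h1, h2]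
    exact mul_mem (pow_mem (Subgroup.subset_closure (by simp)) _)
      (pow_mem (Subgroup.subset_closure (by simp)) _)

lemma exists_mem_sgrp_iff {n : ℕ} (p : Matrix (Fin 2) (Fin 2) (ZMod n) → Prop) :
    (∃ P : GL (Fin 2) (ZMod n), P ∈ Sgrp n ∧ p P) ↔ ∃ g, p (s3Rep (ZMod n) g) := by
  rw [sgrp_eq_range]
  constructor
  · rintro ⟨_, ⟨g, rfl⟩, h⟩
    exact ⟨g, h⟩
  · rintro ⟨g, h⟩
    exact ⟨_, ⟨g, rfl⟩, h⟩

/-- Exchanging the two factors of `S₃ × S₃`. -/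
def swapAction : ℤˣ →* MulAut (DihedralGroup 3 × DihedralGroup 3) where
  toFun u := if u = 1 then 1 else MulEquiv.prodComm
  map_one' := by simp
  map_mul' u v := by
    rcases Int.units_eq_one_or u with rfl | rfl <;> rcases Int.units_eq_one_or v with rfl | rfl <;>
      ext x <;> simp

/-- The wreath product of `S₃` with a group of order two. -/
abbrev BeauvilleGroup : Type :=
  (DihedralGroup 3 × DihedralGroup 3) ⋊[swapAction] ℤˣ

/-- The subtype of matrices counted by `Theta`. -/
abbrev FrakType (n : ℕ) : Type := {A : Matrix (Fin 2) (Fin 2) (ZMod n) // Frak n A}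

section
variable {n : ℕ}

lemma frak_s3Rep_mul_mul (g h : DihedralGroup 3) {A : Matrix (Fin 2) (Fin 2) (ZMod n)}
    (hA : Frak n A) : Frak n (s3Rep _ g * A * s3Rep _ h) := by
  rw [frak_iff] at *
  exact isUnit_frakProd_mul_s3Rep h (isUnit_frakProd_s3Rep_mul g hA)

lemma frak_inv {A : Matrix (Fin 2) (Fin 2) (ZMod n)} (hA : Frak n A) : Frak n A⁻¹ := by
  rw [frak_iff] at *
  exact isUnit_frakProd_inv hA

lemma Frak.isUnit_det {A : Matrix (Fin 2) (Fin 2) (ZMod n)} (hA : Frak n A) : IsUnit A.det :=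
  isUnit_det_of_frakProd ((frak_iff A).1 hA)

noncomputable instance : MulAction BeauvilleGroup (FrakType n) where
  smul x A := ⟨s3Rep _ x.left.1 * (if x.right = 1 then A.1 else A.1⁻¹) * s3Rep _ x.left.2⁻¹, by
    split_ifs
    exacts [frak_s3Rep_mul_mul _ _ A.2, frak_s3Rep_mul_mul _ _ (frak_inv A.2)]⟩
  one_smul A := Subtype.ext <| by
    change s3Rep _ 1 * (if (1 : ℤˣ) = 1 then A.1 else A.1⁻¹) * s3Rep _ (1 : DihedralGroup 3)⁻¹ = A.1
    simp
  mul_smul := by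
    rintro ⟨⟨g, h⟩, u⟩ ⟨⟨g', h'⟩, v⟩ A
    apply Subtype.ext
    change s3Rep _ (((g, h) * swapAction u (g', h')).1) * (if u * v = 1 then A.1 else A.1⁻¹) *
      s3Rep _ (((g, h) * swapAction u (g', h')).2)⁻¹ =
      s3Rep _ g * (if u = 1 then s3Rep _ g' * (if v = 1 then A.1 else A.1⁻¹) * s3Rep _ h'⁻¹ else
      (s3Rep _ g' * (if v = 1 then A.1 else A.1⁻¹) * s3Rep _ h'⁻¹)⁻¹) * s3Rep _ h⁻¹
    have hA := A.2.isUnit_det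
    rcases Int.units_eq_one_or u with rfl | rfl <;> rcases Int.units_eq_one_or v with rfl | rfl <;>
      simp [swapAction, Matrix.mul_inv_rev, inv_s3Rep, mul_assoc,
        Matrix.nonsing_inv_nonsing_inv, hA]

lemma smul_val_one (g h : DihedralGroup 3) (A : FrakType n) :
    ((⟨(g, h), 1⟩ : BeauvilleGroup) • A).1 = s3Rep _ g * A.1 * s3Rep _ h⁻¹ := rfl

lemma smul_val_neg_one (g h : DihedralGroup 3) (A : FrakType n) :
    ((⟨(g, h), -1⟩ : BeauvilleGroup) • A).1 = s3Rep _ g * A.1⁻¹ * s3Rep _ h⁻¹ := rfl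

lemma bRel_iff_orbitRel (A B : FrakType n) :
    BRel n A.1 B.1 ↔ MulAction.orbitRel BeauvilleGroup (FrakType n) B A := by
  have key : BRel n A.1 B.1 ↔ ∃ g h, B.1 = s3Rep _ g * A.1 * s3Rep _ h ∨
      B.1 = s3Rep _ g * A.1⁻¹ * s3Rep _ h := by
    rw [exists_comm, ← exists_mem_sgrp_iff (fun P => ∃ g, B.1 = s3Rep _ g * A.1 * P ∨
      B.1 = s3Rep _ g * A.1⁻¹ * P)]
    refine exists_congr fun P => ?_
    rw [← exists_mem_sgrp_iff (fun Q => B.1 = Q * A.1 * P.1 ∨ B.1 = Q * A.1⁻¹ * P.1)]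
    simp only [← exists_and_left]
  rw [key, MulAction.orbitRel_apply, MulAction.mem_orbit_iff]
  constructor
  · rintro ⟨g, h, H | H⟩
    · exact ⟨⟨(g, h⁻¹), 1⟩, Subtype.ext (by rw [smul_val_one, inv_inv, H])⟩
    · exact ⟨⟨(g, h⁻¹), -1⟩, Subtype.ext (by rw [smul_val_neg_one, inv_inv, H])⟩
  · rintro ⟨⟨⟨g, h⟩, u⟩, rfl⟩
    refine ⟨g, h⁻¹, ?_⟩
    rcases Int.units_eq_one_or u with rfl | rfl
    exacts [.inl rfl, .inr rfl]

lemma theta_eq_card_orbits :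
    Theta n = Nat.card (Quotient (MulAction.orbitRel BeauvilleGroup (FrakType n))) :=
  Nat.card_congr <| Quot.congr (Equiv.refl _) fun A B =>
    (bRel_iff_orbitRel A B).trans ⟨Setoid.symm' _, Setoid.symm' _⟩

/-- The number of `A ∈ 𝔉ₙ` intertwining `g` and `h`. -/
noncomputable def intertwinerCount (n : ℕ) (g h : DihedralGroup 3) : ℕ :=
  Nat.card {A : FrakType n // s3Rep _ g * A.1 = A.1 * s3Rep _ h}

/-- The number of square roots of `g` in `𝔉ₙ`. -/
noncomputable def sqrtCount (n : ℕ) (g : DihedralGroup 3) : ℕ :=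
  Nat.card {A : FrakType n // A.1 * A.1 = s3Rep _ g}

lemma mul_s3Rep_inv_eq_iff (h : DihedralGroup 3) (A B : Matrix (Fin 2) (Fin 2) (ZMod n)) :
    A * s3Rep _ h⁻¹ = B ↔ A = B * s3Rep _ h := by
  constructor
  · rintro rfl
    rw [mul_assoc, s3Rep_inv_mul_cancel, mul_one]
  · rintro rfl
    rw [mul_assoc, s3Rep_mul_inv_cancel, mul_one]

lemma card_fixedBy_one (g h : DihedralGroup 3) :
    Nat.card (MulAction.fixedBy (FrakType n) (⟨(g, h), 1⟩ : BeauvilleGroup)) =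
      intertwinerCount n g h :=
  Nat.card_congr <| Equiv.subtypeEquivRight fun A => by
    rw [MulAction.mem_fixedBy, Subtype.ext_iff, smul_val_one, mul_s3Rep_inv_eq_iff]

/-- Right translation by an element of `S₃` on `𝔉ₙ`. -/
noncomputable def rightTranslate (n : ℕ) (h : DihedralGroup 3) : FrakType n ≃ FrakType n :=
  MulAction.toPerm (⟨(1, h⁻¹), 1⟩ : BeauvilleGroup)

lemma rightTranslate_val (h : DihedralGroup 3) (A : FrakType n) :
    (rightTranslate n h A).1 = A.1 * s3Rep _ h := by
  rw [rightTranslate, MulAction.toPerm_apply, smul_val_one, map_one, one_mul, inv_inv]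

/-- Left translation by an element of `S₃` on `𝔉ₙ`. -/
noncomputable def leftTranslate (n : ℕ) (h : DihedralGroup 3) : FrakType n ≃ FrakType n :=
  MulAction.toPerm (⟨(h, 1), 1⟩ : BeauvilleGroup)

lemma leftTranslate_val (h : DihedralGroup 3) (A : FrakType n) :
    (leftTranslate n h A).1 = s3Rep _ h * A.1 := by
  rw [leftTranslate, MulAction.toPerm_apply, smul_val_one, inv_one, map_one, mul_one]

lemma card_fixedBy_neg_one (g h : DihedralGroup 3) :
    Nat.card (MulAction.fixedBy (FrakType n) (⟨(g, h), -1⟩ : BeauvilleGroup)) =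
      sqrtCount n (g * h) :=
  Nat.card_congr <| (rightTranslate n h).subtypeEquiv fun A => by
    have hA := A.2.isUnit_det
    rw [MulAction.mem_fixedBy, Subtype.ext_iff, smul_val_neg_one, mul_s3Rep_inv_eq_iff,
      rightTranslate_val, map_mul]
    constructor
    · intro H
      rw [← H, Matrix.mul_assoc, H, ← Matrix.mul_assoc (A.1⁻¹),
        Matrix.nonsing_inv_mul _ hA, Matrix.one_mul]
    · intro H
      have h1 : A.1 * s3Rep _ h * A.1 = s3Rep _ g := by
        have := congrArg (· * s3Rep (ZMod n) h⁻¹) H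
        simpa only [mul_assoc, s3Rep_mul_inv_cancel, mul_one] using this
      rw [← h1, Matrix.mul_nonsing_inv_cancel_right _ _ hA]

lemma sqrtCount_conj (g h : DihedralGroup 3) :
    sqrtCount n (h * g * h⁻¹) = sqrtCount n g :=
  (Nat.card_congr <| ((leftTranslate n h).trans (rightTranslate n h⁻¹)).subtypeEquiv fun A => by
    simp only [Equiv.trans_apply, rightTranslate_val, leftTranslate_val, map_mul]
    rw [show s3Rep _ h * A.1 * s3Rep _ h⁻¹ * (s3Rep _ h * A.1 * s3Rep _ h⁻¹) =
      s3Rep _ h * A.1 * (s3Rep _ h⁻¹ * s3Rep _ h) * A.1 * s3Rep _ h⁻¹ by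
        simp only [mul_assoc], s3Rep_inv_mul_cancel, mul_one, mul_s3Rep_inv_eq_iff, mul_assoc,
        mul_assoc, mul_assoc, s3Rep_inv_mul_cancel, mul_one]
    refine ⟨fun H => by rw [H], fun H => ?_⟩
    have := congrArg (s3Rep (ZMod n) h⁻¹ * ·) H
    simpa only [← mul_assoc, s3Rep_inv_mul_cancel, one_mul] using this).symm

lemma intertwinerCount_conj_left (g h k : DihedralGroup 3) :
    intertwinerCount n (k * g * k⁻¹) h = intertwinerCount n g h :=
  (Nat.card_congr <| (leftTranslate n k).subtypeEquiv fun A => by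
    simp only [leftTranslate_val, map_mul]
    rw [show s3Rep _ k * s3Rep _ g * s3Rep _ k⁻¹ * (s3Rep _ k * A.1) =
      s3Rep _ k * s3Rep _ g * (s3Rep _ k⁻¹ * s3Rep _ k) * A.1 by simp only [mul_assoc],
      s3Rep_inv_mul_cancel, mul_one]
    refine ⟨fun H => by rw [mul_assoc, H, mul_assoc], fun H => ?_⟩
    have := congrArg (s3Rep (ZMod n) k⁻¹ * ·) H
    simpa only [← mul_assoc, s3Rep_inv_mul_cancel, one_mul] using this).symm

lemma intertwinerCount_conj_right (g h k : DihedralGroup 3) :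
    intertwinerCount n g (k⁻¹ * h * k) = intertwinerCount n g h :=
  (Nat.card_congr <| (rightTranslate n k).subtypeEquiv fun A => by
    simp only [rightTranslate_val, map_mul]
    rw [show A.1 * s3Rep _ k * (s3Rep _ k⁻¹ * s3Rep _ h * s3Rep _ k) =
      A.1 * (s3Rep _ k * s3Rep _ k⁻¹) * s3Rep _ h * s3Rep _ k by simp only [mul_assoc],
      s3Rep_mul_inv_cancel, mul_one]
    refine ⟨fun H => by rw [← mul_assoc, H], fun H => ?_⟩
    have := congrArg (· * s3Rep (ZMod n) k⁻¹) H
    simpa only [mul_assoc, s3Rep_mul_inv_cancel, mul_one] using this).symm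

lemma burnside [NeZero n] : 72 * Theta n =
    ∑ g, ∑ h, intertwinerCount n g h + 6 * ∑ g, sqrtCount n g := by
  have h1 : Nat.card BeauvilleGroup = 72 := by
    rw [Nat.card_congr SemidirectProduct.equivProd, Nat.card_prod, Nat.card_prod]
    rw [DihedralGroup.nat_card, Nat.card_eq_fintype_card, Fintype.card_units_int]
  have h2 := Nat.card_congr
    (MulAction.sigmaFixedByEquivOrbitsProdGroup BeauvilleGroup (FrakType n))
  have : Fintype BeauvilleGroup := Fintype.ofEquiv _ SemidirectProduct.equivProd.symm
  rw [Nat.card_prod, h1, ← theta_eq_card_orbits, Nat.card_sigma,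
    ← SemidirectProduct.equivProd.symm.sum_comp, Fintype.sum_prod_type] at h2
  have h3 (x : DihedralGroup 3 × DihedralGroup 3) : ∑ u : ℤˣ, Nat.card (MulAction.fixedBy
      (FrakType n) ((SemidirectProduct.equivProd (φ := swapAction)).symm (x, u))) =
      intertwinerCount n x.1 x.2 + sqrtCount n (x.1 * x.2) := by
    rw [show (Finset.univ : Finset ℤˣ) = {1, -1} from rfl, Finset.sum_pair (by decide)]
    exact congrArg₂ _ (card_fixedBy_one ..) (card_fixedBy_neg_one ..)
  simp_rw [h3, Finset.sum_add_distrib, Fintype.sum_prod_type] at h2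
  rw [mul_comm, ← h2]
  congr 1
  have h4 (g : DihedralGroup 3) : ∑ h, sqrtCount n (g * h) = ∑ h, sqrtCount n h :=
    Equiv.sum_comp (Equiv.mulLeft g) _
  simp_rw [h4, Finset.sum_const, Finset.card_univ, DihedralGroup.card, smul_eq_mul]

end

lemma card_subtype_comp_mul_card {G H : Type*} [AddGroup G] [AddGroup H] (f : G →+ H)
    (hf : Function.Surjective f) (P : H → Prop) :
    Nat.card {a // P (f a)} * Nat.card H = Nat.card G * Nat.card {b // P b} := by
  have key (P : H → Prop) : Nat.card {a // P (f a)} = Nat.card {b // P b} * Nat.card f.ker := by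
    obtain ⟨s, hs⟩ := hf.hasRightInverse
    rw [← Nat.card_prod]
    refine Nat.card_congr
      { toFun a := (⟨f a.1, a.2⟩, ⟨a.1 - s (f a.1), by simp [AddMonoidHom.mem_ker, hs (f a.1)]⟩)
        invFun b := ⟨b.2.1 + s b.1.1, by
          have := b.2.2
          rw [AddMonoidHom.mem_ker] at this
          simpa [this, hs b.1.1] using b.1.2⟩
        left_inv a := by simp
        right_inv b := ?_ }
    have := b.2.2
    rw [AddMonoidHom.mem_ker] at this
    ext <;> simp [this, hs b.1.1]
  have hG : Nat.card G = Nat.card H * Nat.card f.ker := by simpa using key fun _ => True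
  rw [hG, key P]
  ring

lemma card_subtype_prod {α β : Type*} [Finite α] [Finite β] {P : α → Prop} {Q : α → β → Prop}
    {k : ℕ} (h : ∀ a, P a → Nat.card {b // Q a b} = k) :
    Nat.card {x : α × β // P x.1 ∧ Q x.1 x.2} = Nat.card {a // P a} * k := by
  have : Fintype {a // P a} := Fintype.ofFinite _
  have e : {x : α × β // P x.1 ∧ Q x.1 x.2} ≃ Σ a : {a // P a}, {b // Q a.1 b} :=
    { toFun x := ⟨⟨x.1.1, x.2.1⟩, ⟨x.1.2, x.2.2⟩⟩
      invFun y := ⟨(y.1.1, y.2.1), y.1.2, y.2.2⟩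
      left_inv _ := rfl
      right_inv _ := rfl }
  rw [Nat.card_congr e, Nat.card_sigma, Finset.sum_congr rfl fun a _ => h a.1 a.2]
  simp

lemma card_notMem {α : Type*} [Finite α] (s : Finset α) :
    Nat.card {a // a ∉ s} = Nat.card α - s.card := by
  classical
  have : Fintype α := Fintype.ofFinite α
  rw [Nat.card_eq_fintype_card, Nat.card_eq_fintype_card, ← Finset.card_compl,
    Fintype.card_subtype, Finset.compl_eq_univ_sdiff, Finset.sdiff_eq_filter]

section
variable {K : Type*} [Field K]

lemma frakProd_ne_zero_iff_of_slopes [DecidableEq K] (a t u c : K) :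
    frakProd !![a, t * a; c, u * c] ≠ 0 ↔
      ((a ∉ ({0} : Finset K) ∧ t ∉ ({0, -1} : Finset K)) ∧ u ∉ ({0, -1, t} : Finset K)) ∧
        c ∉ ({0, a, t * a / u, (1 + t) * a / (1 + u)} : Finset K) := by
  have e : frakProd !![a, t * a; c, u * c] = (a * t * (1 + t) * u * (1 + u) * (u - t)) *
      (c * (a - c) * (t * a - u * c) * ((1 + t) * a - (1 + u) * c)) * (a ^ 3 * c ^ 3) := by
    simp [frakProd]; ring
  rw [e]
  simp only [mul_ne_zero_iff, Finset.mem_insert, Finset.mem_singleton, not_or]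
  constructor
  · rintro ⟨⟨⟨⟨⟨⟨⟨ha, ht⟩, ht'⟩, hu⟩, hu'⟩, hut⟩, ⟨⟨hc, hac⟩, h1⟩, h2⟩, -⟩
    rw [eq_div_iff hu, eq_div_iff hu']
    exact ⟨⟨⟨ha, ht, fun h => ht' (by linear_combination h)⟩, hu,
      fun h => hu' (by linear_combination h), sub_ne_zero.1 hut⟩, hc,
      fun h => hac (by linear_combination -h), fun h => h1 (by linear_combination -h),
      fun h => h2 (by linear_combination -h)⟩
  · rintro ⟨⟨⟨ha, ht, ht'⟩, hu, hu', hut⟩, hc, hac, h1, h2⟩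
    have hu'' : 1 + u ≠ 0 := fun h => hu' (by linear_combination h)
    rw [eq_div_iff hu] at h1
    rw [eq_div_iff hu''] at h2
    exact ⟨⟨⟨⟨⟨⟨⟨ha, ht⟩, fun h => ht' (by linear_combination h)⟩, hu⟩, hu''⟩,
      sub_ne_zero.2 hut⟩, ⟨⟨hc, fun h => hac (by linear_combination -h)⟩,
      fun h => h1 (by linear_combination -h)⟩, fun h => h2 (by linear_combination -h)⟩,
      by simp [ha], by simp [hc]⟩

variable [Finite K]

lemma card_frakProd_ne_zero :
    Nat.card {A : Matrix (Fin 2) (Fin 2) K // frakProd A ≠ 0} =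
      (Nat.card K - 1) * (Nat.card K - 2) * (Nat.card K - 3) * (Nat.card K - 4) := by
  classical
  let e : {A : Matrix (Fin 2) (Fin 2) K // frakProd A ≠ 0} ≃ {x : ((K × K) × K) × K //
      ((x.1.1.1 ∉ ({0} : Finset K) ∧ x.1.1.2 ∉ ({0, -1} : Finset K)) ∧
        x.1.2 ∉ ({0, -1, x.1.1.2} : Finset K)) ∧
      x.2 ∉ ({0, x.1.1.1, x.1.1.2 * x.1.1.1 / x.1.2,
        (1 + x.1.1.2) * x.1.1.1 / (1 + x.1.2)} : Finset K)} :=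
    have h (A : Matrix (Fin 2) (Fin 2) K) (hA : frakProd A ≠ 0) :
        !![A 0 0, A 0 1 / A 0 0 * A 0 0; A 1 0, A 1 1 / A 1 0 * A 1 0] = A := by
      simp only [frakProd, mul_ne_zero_iff] at hA
      rw [div_mul_cancel₀ _ (by tauto), div_mul_cancel₀ _ (by tauto), ← eta_fin_two]
    { toFun A := ⟨(((A.1 0 0, A.1 0 1 / A.1 0 0), A.1 1 1 / A.1 1 0), A.1 1 0), by
        rw [← frakProd_ne_zero_iff_of_slopes, h A.1 A.2]; exact A.2⟩
      invFun x := ⟨!![x.1.1.1.1, x.1.1.1.2 * x.1.1.1.1; x.1.2, x.1.1.2 * x.1.2],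
        (frakProd_ne_zero_iff_of_slopes ..).2 x.2⟩
      left_inv A := Subtype.ext (h A.1 A.2)
      right_inv x := by
        have := x.2
        simp only [Finset.mem_insert, Finset.mem_singleton, not_or] at this
        apply Subtype.ext
        simp [this] }
  rw [Nat.card_congr e,
    card_subtype_prod (P := fun x : (K × K) × K => (x.1.1 ∉ ({0} : Finset K) ∧
      x.1.2 ∉ ({0, -1} : Finset K)) ∧ x.2 ∉ ({0, -1, x.1.2} : Finset K))
      (Q := fun x c => c ∉ ({0, x.1.1, x.1.2 * x.1.1 / x.2,
        (1 + x.1.2) * x.1.1 / (1 + x.2)} : Finset K)) (k := Nat.card K - 4),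
    card_subtype_prod (P := fun x : K × K => x.1 ∉ ({0} : Finset K) ∧ x.2 ∉ ({0, -1} : Finset K))
      (Q := fun x u => u ∉ ({0, -1, x.2} : Finset K)) (k := Nat.card K - 3),
    card_subtype_prod (P := fun x : K => x ∉ ({0} : Finset K))
      (Q := fun _ u => u ∉ ({0, -1} : Finset K)) (k := Nat.card K - 2), card_notMem]
  · simp
  · intro a ha
    rw [card_notMem, Finset.card_pair (by simp)]
  · intro a ha
    rw [card_notMem, Finset.card_eq_three.2 ⟨0, -1, a.2, by simp, by grind, by grind, rfl⟩]
  · intro a ha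
    rw [card_notMem]
    congr 1
    repeat rw [Finset.card_insert_of_notMem]
    · simp
    all_goals simp; grind

lemma card_commutant_pairs {w : K} (hw : w ^ 2 + w + 1 = 0) (h3 : (3 : K) ≠ 0) :
    Nat.card {x : K × K // x.1 * x.2 * (x.1 - x.2) * (x.1 ^ 2 - x.1 * x.2 + x.2 ^ 2) ≠ 0} =
      (Nat.card K - 1) * (Nat.card K - 4) := by
  classical
  have h (x : K × K) : x.1 * x.2 * (x.1 - x.2) * (x.1 ^ 2 - x.1 * x.2 + x.2 ^ 2) ≠ 0 ↔
      x.1 ∉ ({0} : Finset K) ∧ x.2 ∉ ({0, x.1, - w * x.1, (1 + w) * x.1} : Finset K) := by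
    have e : x.1 ^ 2 - x.1 * x.2 + x.2 ^ 2 = (x.2 + w * x.1) * (x.2 - (1 + w) * x.1) := by
      linear_combination x.1 ^ 2 * hw
    rw [e]
    simp only [mul_ne_zero_iff, Finset.mem_insert, Finset.mem_singleton, not_or]
    grind
  rw [Nat.card_congr (Equiv.subtypeEquivRight h), card_subtype_prod (P := fun a => a ∉ _)
    (Q := fun a b => b ∉ ({0, a, - w * a, (1 + w) * a} : Finset K)) (k := Nat.card K - 4),
    card_notMem, Finset.card_singleton]
  intro a ha
  rw [card_notMem]
  congr 1
  repeat rw [Finset.card_insert_of_notMem]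
  · simp
  all_goals simp; grind

lemma card_involution_pairs (h2 : (2 : K) ≠ 0) :
    Nat.card {x : K × K // x.1 * x.2 * (1 - x.1 ^ 2) * (x.1 + x.2) * (1 - x.1 ^ 2 - x.1 * x.2) *
      ((x.1 + x.2) ^ 2 - 1) ≠ 0} = (Nat.card K - 3) * (Nat.card K - 5) := by
  classical
  have h (x : K × K) : x.1 * x.2 * (1 - x.1 ^ 2) * (x.1 + x.2) * (1 - x.1 ^ 2 - x.1 * x.2) *
      ((x.1 + x.2) ^ 2 - 1) ≠ 0 ↔ x.1 ∉ ({0, 1, -1} : Finset K) ∧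
        x.2 ∉ ({0, -x.1, x.1⁻¹ - x.1, 1 - x.1, -1 - x.1} : Finset K) := by
    simp only [mul_ne_zero_iff, Finset.mem_insert, Finset.mem_singleton, not_or]
    grind
  rw [Nat.card_congr (Equiv.subtypeEquivRight h), card_subtype_prod (P := fun a => a ∉ _)
    (Q := fun a b => b ∉ ({0, -a, a⁻¹ - a, 1 - a, -1 - a} : Finset K)) (k := Nat.card K - 5),
    card_notMem]
  · congr 2
    repeat rw [Finset.card_insert_of_notMem]
    · simp
    all_goals simp; try grind
  intro a ha
  rw [card_notMem]
  congr 1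
  repeat rw [Finset.card_insert_of_notMem]
  · simp
  all_goals simp; grind

end

section
variable {p e : ℕ} [Fact p.Prime]

/-- Reduction from `ℤ/p^eℤ` to `ℤ/pℤ`. -/
def reduction (he : e ≠ 0) : ZMod (p ^ e) →+* ZMod p :=
  ZMod.castHom (dvd_pow_self p he) (ZMod p)

lemma isUnit_iff_reduction_ne_zero (he : e ≠ 0) (x : ZMod (p ^ e)) :
    IsUnit x ↔ reduction he x ≠ 0 := by
  obtain ⟨m, rfl⟩ := ZMod.natCast_zmod_surjective x
  rw [map_natCast, ZMod.isUnit_iff_coprime, Nat.coprime_pow_right_iff (Nat.pos_of_ne_zero he),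
    Nat.coprime_comm, (Fact.out : p.Prime).coprime_iff_not_dvd, Ne, ZMod.natCast_eq_zero_iff]

lemma reduction_surjective (he : e ≠ 0) : Function.Surjective (reduction (p := p) he) :=
  ZMod.ringHom_surjective _

lemma card_isUnit_pairs (he : e ≠ 0) (P : ZMod (p ^ e) × ZMod (p ^ e) → ZMod (p ^ e))
    (P' : ZMod p × ZMod p → ZMod p)
    (hP : ∀ x, reduction he (P x) = P' (reduction he x.1, reduction he x.2)) :
    Nat.card {x // IsUnit (P x)} * p ^ 2 = (p ^ e) ^ 2 * Nat.card {x // P' x ≠ 0} := by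
  have h := card_subtype_comp_mul_card
    (AddMonoidHom.prodMap (reduction (p := p) he).toAddMonoidHom
      (reduction (p := p) he).toAddMonoidHom)
    (Function.Surjective.prodMap (reduction_surjective he) (reduction_surjective he))
    (fun x => P' x ≠ 0)
  rw [Nat.card_prod, Nat.card_prod, Nat.card_zmod, Nat.card_zmod, ← sq, ← sq] at h
  rw [← h]
  congr 1
  exact Nat.card_congr (Equiv.subtypeEquivRight fun x => by
    rw [isUnit_iff_reduction_ne_zero he, hP]; rfl)

lemma card_frakType_mul (he : e ≠ 0) : Nat.card (FrakType (p ^ e)) * p ^ 4 =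
    (p ^ e) ^ 4 * ((p - 1) * (p - 2) * (p - 3) * (p - 4)) := by
  have h := card_subtype_comp_mul_card
    ((reduction (p := p) he).mapMatrix (m := Fin 2) : Matrix (Fin 2) (Fin 2) (ZMod (p ^ e)) →+ _)
    (fun B => ⟨B.map (Function.surjInv (reduction_surjective he)), by
      ext i j; simp [Function.surjInv_eq]⟩) (fun A => frakProd A ≠ 0)
  have hc (n : ℕ) : Nat.card (Matrix (Fin 2) (Fin 2) (ZMod n)) = n ^ 4 := by
    simp only [Matrix, Nat.card_fun, Nat.card_zmod, Nat.card_eq_fintype_card, Fintype.card_fin]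
    rw [← pow_mul]
  rw [card_frakProd_ne_zero, hc, hc, Nat.card_zmod] at h
  rw [← h]
  congr 1
  exact Nat.card_congr (Equiv.subtypeEquivRight fun A => by
    rw [frak_iff, isUnit_iff_reduction_ne_zero he, ← frakProd_map]; rfl)

lemma natCast_ne_zero {m : ℕ} (hm : 0 < m) (hmp : m < p) : (m : ZMod p) ≠ 0 := by
  rw [Ne, ZMod.natCast_eq_zero_iff]
  exact Nat.not_dvd_of_pos_of_lt hm hmp

lemma natCast_isUnit (he : e ≠ 0) {m : ℕ} (hm : 0 < m) (hmp : m < p) :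
    IsUnit (m : ZMod (p ^ e)) := by
  rw [isUnit_iff_reduction_ne_zero he, map_natCast]
  exact natCast_ne_zero hm hmp

lemma exists_cube_root (he : e ≠ 0) (hp3 : 3 < p) (hmod : p % 3 = 1) :
    ∃ w : ZMod (p ^ e), w ^ 2 + w + 1 = 0 := by
  have hp : p.Prime := Fact.out
  have : Fact (Nat.Prime 3) := ⟨Nat.prime_three⟩
  have h3 : IsUnit (3 : ZMod (p ^ e)) := by
    exact_mod_cast natCast_isUnit (p := p) he (m := 3) (by norm_num) hp3
  obtain ⟨u, hu⟩ := exists_prime_orderOf_dvd_card (G := (ZMod (p ^ e))ˣ) 3 (by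
    rw [ZMod.card_units_eq_totient, Nat.totient_prime_pow hp (Nat.pos_of_ne_zero he)]
    exact Dvd.dvd.mul_left (by omega) _)
  have hu1 : (u : ZMod (p ^ e)) ≠ 1 := by
    rintro h
    rw [Units.val_eq_one.1 h, orderOf_one] at hu
    norm_num at hu
  have hu3 : (u : ZMod (p ^ e)) ^ 3 = 1 := by
    rw [← Units.val_pow_eq_pow_val, ← hu, pow_orderOf_eq_one, Units.val_one]
  refine ⟨u, ?_⟩
  set w := (u : ZMod (p ^ e))
  have hw : (w - 1) * (w ^ 2 + w + 1) = 0 := by linear_combination hu3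
  suffices IsUnit (w - 1) from (this.mul_right_eq_zero).1 hw
  by_contra hn
  rw [isUnit_iff_reduction_ne_zero he, not_not] at hn
  have h : IsUnit (w ^ 2 + w + 1) := by
    rw [isUnit_iff_reduction_ne_zero he] at h3 ⊢
    rwa [show w ^ 2 + w + 1 = (w - 1) * (w + 2) + 3 by ring, map_add, map_mul, hn, zero_mul,
      zero_add]
  exact hu1 (sub_eq_zero.1 (h.mul_left_eq_zero.1 hw))

lemma isUnit_frakProd_commutant_iff {R : Type*} [CommRing R] (x y : R) :
    IsUnit (frakProd !![x - y, y; -y, x]) ↔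
      IsUnit (x * y * (x - y) * (x ^ 2 - x * y + y ^ 2)) := by
  have h : frakProd !![x - y, y; -y, x] =
      (x * y * (x - y)) ^ 3 * (x ^ 2 - x * y + y ^ 2) := by
    simp [frakProd]; ring
  rw [h, IsUnit.mul_iff, isUnit_pow_iff three_ne_zero, ← IsUnit.mul_iff]

lemma s3Rep_r_one_commute_iff {R : Type*} [CommRing R] (A : Matrix (Fin 2) (Fin 2) R) :
    s3Rep R (.r 1) * A = A * s3Rep R (.r 1) ↔
      A = !![A 1 1 - A 0 1, A 0 1; -A 0 1, A 1 1] := by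
  constructor
  · intro h
    have h00 := congrFun₂ h 0 0
    have h01 := congrFun₂ h 0 1
    simp [s3Rep_r_one, mul_apply] at h00 h01
    ext i j
    fin_cases i <;> fin_cases j <;> simp
    · linear_combination -h01
    · linear_combination h00
  · intro h
    rw [h, s3Rep_r_one]
    ext i j
    fin_cases i <;> fin_cases j <;> simp [mul_apply] <;> ring

lemma intertwinerCount_r_one_mul (he : e ≠ 0) (hp3 : 3 < p) (hmod : p % 3 = 1) :
    intertwinerCount (p ^ e) (.r 1) (.r 1) * p ^ 2 = (p ^ e) ^ 2 * ((p - 1) * (p - 4)) := by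
  obtain ⟨w, hw⟩ := exists_cube_root (p := p) he hp3 hmod
  have h := card_commutant_pairs (w := reduction he w) (by simpa using congrArg (reduction he) hw)
    (by exact_mod_cast natCast_ne_zero (m := 3) (by norm_num) hp3)
  rw [Nat.card_zmod] at h
  rw [← h, ← card_isUnit_pairs he
    (fun x => x.1 * x.2 * (x.1 - x.2) * (x.1 ^ 2 - x.1 * x.2 + x.2 ^ 2)) _ (by simp)]
  congr 1
  exact Nat.card_congr
    { toFun A := ⟨(A.1.1 1 1, A.1.1 0 1), by
        rw [← isUnit_frakProd_commutant_iff, ← (s3Rep_r_one_commute_iff _).1 A.2, ← frak_iff]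
        exact A.1.2⟩
      invFun x := ⟨⟨!![x.1.1 - x.1.2, x.1.2; -x.1.2, x.1.1], by
        rw [frak_iff, isUnit_frakProd_commutant_iff]; exact x.2⟩, by
        rw [s3Rep_r_one_commute_iff]; simp⟩
      left_inv A := Subtype.ext (Subtype.ext ((s3Rep_r_one_commute_iff _).1 A.2).symm)
      right_inv x := by simp }

lemma isUnit_frakProd_involution_iff {R : Type*} [CommRing R] {a b c : R}
    (h : b * c = 1 - a ^ 2) : IsUnit (frakProd !![a, b; c, -a]) ↔
      IsUnit (a * b * (1 - a ^ 2) * (a + b) * (1 - a ^ 2 - a * b) * ((a + b) ^ 2 - 1)) := by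
  have h1 : frakProd !![a, b; c, -a] = -(c - a) ^ 2 * a ^ 2 * b * c * (a + b) ^ 2 *
      (2 * a + b - c) := by
    have : a * -a - b * c = -1 := by linear_combination -h
    simp only [frakProd, of_apply, cons_val', cons_val_zero, cons_val_one, cons_val_fin_one, this]
    ring
  have h2 : 1 - a ^ 2 - a * b = b * (c - a) := by linear_combination -h
  have h3 : (a + b) ^ 2 - 1 = b * (2 * a + b - c) := by linear_combination h
  rw [h1, h2, h3, ← h]
  simp only [IsUnit.mul_iff, IsUnit.neg_iff, isUnit_pow_iff two_ne_zero]
  tauto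

lemma mul_self_eq_one_iff_of_isUnit {R : Type*} [CommRing R] {A : Matrix (Fin 2) (Fin 2) R}
    (hA : IsUnit (A 0 1)) : A * A = 1 ↔ A 1 1 = - A 0 0 ∧ A 0 1 * A 1 0 = 1 - A 0 0 ^ 2 := by
  constructor
  · intro h
    have h00 := congrFun₂ h 0 0
    have h01 := congrFun₂ h 0 1
    simp [mul_apply] at h00 h01
    have h01' : A 0 1 * (A 0 0 + A 1 1) = 0 := by linear_combination h01
    exact ⟨by linear_combination hA.mul_right_eq_zero.1 h01', by linear_combination h00⟩
  · rintro ⟨h, h'⟩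
    ext i j
    fin_cases i <;> fin_cases j <;> simp [mul_apply, h]
    · linear_combination h'
    · ring
    · ring
    · linear_combination h'

lemma sqrtCount_r_zero_mul (he : e ≠ 0) (hp2 : 2 < p) :
    sqrtCount (p ^ e) (.r 0) * p ^ 2 = (p ^ e) ^ 2 * ((p - 3) * (p - 5)) := by
  have h := card_involution_pairs (K := ZMod p)
    (by exact_mod_cast natCast_ne_zero (m := 2) (by norm_num) hp2)
  rw [Nat.card_zmod] at h
  rw [← h, ← card_isUnit_pairs he
    (fun x => x.1 * x.2 * (1 - x.1 ^ 2) * (x.1 + x.2) * (1 - x.1 ^ 2 - x.1 * x.2) *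
      ((x.1 + x.2) ^ 2 - 1)) _ (by simp)]
  congr 1
  have key (A : {A : FrakType (p ^ e) // A.1 * A.1 = s3Rep _ (.r 0)}) :
      A.1.1 1 1 = - A.1.1 0 0 ∧ A.1.1 0 1 * A.1.1 1 0 = 1 - A.1.1 0 0 ^ 2 :=
    (mul_self_eq_one_iff_of_isUnit A.1.2.2.2.1).1 (A.2.trans s3Rep_r_zero)
  have hu {x : ZMod (p ^ e) × ZMod (p ^ e)} (hx : IsUnit (x.1 * x.2 * (1 - x.1 ^ 2) * (x.1 + x.2) *
      (1 - x.1 ^ 2 - x.1 * x.2) * ((x.1 + x.2) ^ 2 - 1))) : IsUnit x.2 := by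
    simp only [IsUnit.mul_iff] at hx
    tauto
  have hc {x : ZMod (p ^ e) × ZMod (p ^ e)} (hx : IsUnit x.2) :
      x.2 * (Ring.inverse x.2 * (1 - x.1 ^ 2)) = 1 - x.1 ^ 2 := by
    rw [← mul_assoc, Ring.mul_inverse_cancel _ hx, one_mul]
  exact Nat.card_congr
    { toFun A := ⟨(A.1.1 0 0, A.1.1 0 1), by
        rw [← isUnit_frakProd_involution_iff (key A).2, ← (key A).1, ← eta_fin_two, ← frak_iff]
        exact A.1.2⟩
      invFun x := ⟨⟨!![x.1.1, x.1.2; Ring.inverse x.1.2 * (1 - x.1.1 ^ 2), -x.1.1], by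
        rw [frak_iff, isUnit_frakProd_involution_iff (hc (hu x.2))]; exact x.2⟩, by
        rw [s3Rep_r_zero, mul_self_eq_one_iff_of_isUnit (by simpa using hu x.2)]
        exact ⟨rfl, hc (hu x.2)⟩⟩
      left_inv A := Subtype.ext (Subtype.ext (by
        conv_rhs => rw [eta_fin_two A.1.1]
        dsimp only
        rw [(key A).1, ← (key A).2, Ring.inverse_mul_cancel_left _ _ A.1.2.2.2.1]))
      right_inv x := by simp }

lemma sqrt_r_one_eq {R : Type*} [CommRing R] {A : Matrix (Fin 2) (Fin 2) R}
    (hA : IsUnit (frakProd A)) (h : A * A = s3Rep R (.r 1)) :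
    A = !![-2 * A 0 1, A 0 1; -A 0 1, - A 0 1] ∧ 3 * A 0 1 ^ 2 = -1 := by
  have hc := (s3Rep_r_one_commute_iff A).1 (by rw [← h, mul_assoc])
  have h00 := congrFun₂ hc 0 0
  have h10 := congrFun₂ hc 1 0
  have g01 := congrFun₂ h 0 1
  have g11 := congrFun₂ h 1 1
  simp [mul_apply, s3Rep_r_one] at h00 h10 g01 g11
  have hu : IsUnit (A 0 0) := by
    simp only [frakProd, IsUnit.mul_iff] at hA
    tauto
  have h11 : A 0 0 * (A 1 1 + A 0 1) = 0 := by
    rw [h10] at g11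
    rw [h00]
    linear_combination g11
  replace h11 := hu.mul_right_eq_zero.1 h11
  refine ⟨?_, ?_⟩
  · ext i j
    fin_cases i <;> fin_cases j <;> simp [h10]
    · linear_combination h00 + h11
    · linear_combination h11
  · rw [h00] at g01
    linear_combination -g01 + 2 * A 0 1 * h11

lemma sqrtCount_r_one (he : e ≠ 0) (hp3 : 3 < p) (hmod : p % 3 = 1) :
    sqrtCount (p ^ e) (.r 1) = 2 := by
  obtain ⟨w, hw⟩ := exists_cube_root (p := p) he hp3 hmod
  have h2 : IsUnit (2 : ZMod (p ^ e)) := by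
    exact_mod_cast natCast_isUnit (p := p) he (m := 2) (by norm_num) (by omega)
  have h3 : IsUnit (3 : ZMod (p ^ e)) := by
    exact_mod_cast natCast_isUnit (p := p) he (m := 3) (by norm_num) hp3
  obtain ⟨t, ht⟩ := h3.exists_right_inv
  set s := t * (2 * w + 1) with hs
  have hs3 : 3 * s ^ 2 = -1 := by
    rw [hs]
    linear_combination 12 * t ^ 2 * hw - (1 + 3 * t) * ht
  have hsu : IsUnit s := by
    refine IsUnit.of_mul_eq_one (-3 * s) ?_
    linear_combination -hs3
  have hF (y : ZMod (p ^ e)) (hy : IsUnit y) (hy3 : 3 * y ^ 2 = -1) :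
      Frak (p ^ e) !![-2 * y, y; -y, -y] ∧
        !![-2 * y, y; -y, -y] * !![-2 * y, y; -y, -y] = s3Rep (ZMod (p ^ e)) (.r 1) := by
    constructor
    · rw [frak_iff, show frakProd !![-2 * y, y; -y, -y] = (2 * y ^ 3) ^ 3 * (3 * y ^ 2) by
        simp [frakProd]; ring, hy3]
      exact ((h2.mul (hy.pow 3)).pow 3).mul isUnit_one.neg
    · rw [s3Rep_r_one]
      ext i j
      fin_cases i <;> fin_cases j <;> simp [mul_apply]
      · linear_combination hy3
      · linear_combination -hy3
      · linear_combination hy3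
  obtain ⟨f1, g1⟩ := hF s hsu hs3
  obtain ⟨f2, g2⟩ := hF (-s) hsu.neg (by rw [neg_sq, hs3])
  refine Nat.card_eq_two_iff.2 ⟨⟨⟨_, f1⟩, g1⟩, ⟨⟨_, f2⟩, g2⟩, ?_, ?_⟩
  · intro h
    have h' : s = -s := congrFun₂ (congrArg (fun A => A.1.1) h) 0 1
    have h'' : 2 * s = 0 := by linear_combination h'
    rw [h2.mul_right_eq_zero] at h''
    rw [h'', isUnit_iff_reduction_ne_zero he, map_zero] at hsu
    exact hsu rfl
  · refine Set.eq_univ_of_forall fun ⟨⟨A, hA⟩, hAA⟩ => ?_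
    obtain ⟨k1, k2⟩ := sqrt_r_one_eq ((frak_iff A).1 hA) hAA
    set y := A 0 1
    have hys : (y - s) * (y + s) = 0 := h3.mul_right_eq_zero.1 (by linear_combination k2 - hs3)
    by_cases hu : IsUnit (y - s)
    · right
      have hy : y = -s := by linear_combination hu.mul_right_eq_zero.1 hys
      exact Subtype.ext (Subtype.ext (by rw [hy] at k1; exact k1))
    · left
      have hu' : IsUnit (y + s) := by
        have := h2.mul hsu
        rw [isUnit_iff_reduction_ne_zero he] at this hu ⊢
        rw [not_not] at hu
        rwa [show y + s = y - s + 2 * s by ring, map_add, hu, zero_add]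
      have hy : y = s := by linear_combination hu'.mul_left_eq_zero.1 hys
      exact Subtype.ext (Subtype.ext (by rw [hy] at k1; exact k1))

lemma intertwinerCount_one_one (n : ℕ) :
    intertwinerCount n (.r 0) (.r 0) = Nat.card (FrakType n) :=
  Nat.card_congr (Equiv.subtypeUnivEquiv fun A => by simp)

lemma intertwinerCount_eq_zero_of_trace {n : ℕ} {g h : DihedralGroup 3}
    (H : (s3Rep (ZMod n) g).trace ≠ (s3Rep (ZMod n) h).trace) : intertwinerCount n g h = 0 := by
  have : IsEmpty {A : FrakType n // s3Rep _ g * A.1 = A.1 * s3Rep _ h} :=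
    ⟨fun A => H (trace_eq_of_intertwine A.1.2.isUnit_det A.2)⟩
  exact Nat.card_of_isEmpty

lemma intertwinerCount_reflections {n : ℕ} [Nontrivial (ZMod n)] (i j : ZMod 3) :
    intertwinerCount n (.sr i) (.sr j) = 0 := by
  have : IsEmpty {A : FrakType n // s3Rep _ (.sr i) * A.1 = A.1 * s3Rep _ (.sr j)} :=
    ⟨fun A => by simpa [frakProd_eq_zero_of_reflections i j A.2] using (frak_iff _).1 A.1.2⟩
  exact Nat.card_of_isEmpty

lemma sqrtCount_reflection {n : ℕ} [Nontrivial (ZMod n)] (i : ZMod 3) :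
    sqrtCount n (.sr i) = 0 := by
  have : IsEmpty {A : FrakType n // A.1 * A.1 = s3Rep _ (.sr i)} :=
    ⟨fun ⟨A, hA⟩ => by
      have h : s3Rep _ (.sr i) * A.1 = A.1 * s3Rep _ (.sr i) := by rw [← hA, mul_assoc]
      simpa [frakProd_eq_zero_of_reflections i i h] using (frak_iff _).1 A.2⟩
  exact Nat.card_of_isEmpty

lemma sum_intertwinerCount (he : e ≠ 0) (hp3 : 3 < p) : ∑ g, ∑ h, intertwinerCount (p ^ e) g h =
    Nat.card (FrakType (p ^ e)) + 4 * intertwinerCount (p ^ e) (.r 1) (.r 1) := by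
  have : Fact (1 < p ^ e) := ⟨Nat.one_lt_pow he (by omega)⟩
  have h2 : (2 : ZMod (p ^ e)) ≠ 0 := by
    exact_mod_cast (natCast_isUnit (p := p) he (m := 2) (by norm_num) (by omega)).ne_zero
  have h3 : (3 : ZMod (p ^ e)) ≠ 0 := by
    exact_mod_cast (natCast_isUnit (p := p) he (m := 3) (by norm_num) hp3).ne_zero
  have tr0 : (s3Rep (ZMod (p ^ e)) (.r 0)).trace = 2 := by simp
  have tr1 : (s3Rep (ZMod (p ^ e)) (.r 1)).trace = -1 := by simp [s3Rep_r_one, trace_fin_two]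
  have tr2 : (s3Rep (ZMod (p ^ e)) (.r 2)).trace = -1 := by simp [s3Rep_r_two, trace_fin_two]
  have trs (i : ZMod 3) : (s3Rep (ZMod (p ^ e)) (.sr i)).trace = 0 := by
    fin_cases i
    · exact (congrArg _ s3Rep_sr_zero).trans (by simp [trace_fin_two])
    · exact (congrArg _ s3Rep_sr_one).trans (by simp [trace_fin_two])
    · exact (congrArg _ s3Rep_sr_two).trans (by simp [trace_fin_two])
  have h21 : (2 : ZMod (p ^ e)) ≠ -1 := fun h => h3 (by linear_combination h)
  have h10 : (-1 : ZMod (p ^ e)) ≠ 0 := by simp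
  have z (g h : DihedralGroup 3) := intertwinerCount_eq_zero_of_trace (n := p ^ e) (g := g) (h := h)
  have rs (i : ZMod 3) (h : DihedralGroup 3) (hh : (s3Rep (ZMod (p ^ e)) h).trace ≠ 0) :
      intertwinerCount (p ^ e) (.sr i) h = 0 ∧ intertwinerCount (p ^ e) h (.sr i) = 0 :=
    ⟨z _ _ (by rw [trs]; exact hh.symm), z _ _ (by rw [trs]; exact hh)⟩
  have rs0 (i : ZMod 3) := rs i (.r 0) (by rwa [tr0])
  have rs1 (i : ZMod 3) := rs i (.r 1) (by rwa [tr1])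
  have rs2 (i : ZMod 3) := rs i (.r 2) (by rwa [tr2])
  have c21 : intertwinerCount (p ^ e) (.r 2) (.r 1) = intertwinerCount (p ^ e) (.r 1) (.r 1) :=
    intertwinerCount_conj_left (.r 1) (.r 1) (.sr 0)
  have c12 (g) : intertwinerCount (p ^ e) g (.r 2) = intertwinerCount (p ^ e) g (.r 1) :=
    intertwinerCount_conj_right g (.r 1) (.sr 0)
  simp only [s3_sum, rs0, rs1, rs2, intertwinerCount_reflections, c12, c21,
    z (.r 0) (.r 1) (by rwa [tr0, tr1]), z (.r 1) (.r 0) (by rw [tr0, tr1]; exact h21.symm),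
    z (.r 2) (.r 0) (by rw [tr0, tr2]; exact h21.symm), intertwinerCount_one_one]
  ring

lemma sum_sqrtCount (he : e ≠ 0) (hp3 : 3 < p) (hmod : p % 3 = 1) :
    ∑ g, sqrtCount (p ^ e) g = sqrtCount (p ^ e) (.r 0) + 4 := by
  have : Fact (1 < p ^ e) := ⟨Nat.one_lt_pow he (by omega)⟩
  have c2 : sqrtCount (p ^ e) (.r 2) = sqrtCount (p ^ e) (.r 1) :=
    sqrtCount_conj (.r 1) (.sr 0)
  simp only [s3_sum, sqrtCount_reflection, c2, sqrtCount_r_one he hp3 hmod,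
    add_zero, add_assoc, Nat.reduceAdd]

end

/-- For a prime `p ≥ 5` with `p ≡ 1 (mod 3)` and `e ≥ 1`,
`72·Θ(p^e) = p^{4e} - 10p^{4e-1} + 35p^{4e-2} - 50p^{4e-3} + 24p^{4e-4}
            + 10p^{2e} - 68p^{2e-1} + 106p^{2e-2} + 24`. -/
theorem theta_prime_pow_one_mod_three (p : ℕ) (hp : p.Prime) (hp5 : 5 ≤ p)
    (hmod : p % 3 = 1) (e : ℕ) (he : 1 ≤ e) :
    (72 * Theta (p ^ e) : ℤ) =
      (p : ℤ) ^ (4 * e) - 10 * (p : ℤ) ^ (4 * e - 1) + 35 * (p : ℤ) ^ (4 * e - 2)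
        - 50 * (p : ℤ) ^ (4 * e - 3) + 24 * (p : ℤ) ^ (4 * e - 4)
        + 10 * (p : ℤ) ^ (2 * e) - 68 * (p : ℤ) ^ (2 * e - 1)
        + 106 * (p : ℤ) ^ (2 * e - 2) + 24 := by
  have : Fact p.Prime := ⟨hp⟩
  obtain ⟨q, rfl⟩ : ∃ q, p = q + 5 := ⟨p - 5, by omega⟩
  obtain ⟨k, rfl⟩ : ∃ k, e = k + 1 := ⟨e - 1, by omega⟩
  have hb := burnside (n := (q + 5) ^ (k + 1))
  have h1 := card_frakType_mul (p := q + 5) (e := k + 1) (by omega)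
  have h2 := intertwinerCount_r_one_mul (p := q + 5) (e := k + 1) (by omega) (by omega) hmod
  have h3 := sqrtCount_r_zero_mul (p := q + 5) (e := k + 1) (by omega) (by omega)
  rw [sum_intertwinerCount (by omega) (by omega),
    sum_sqrtCount (by omega) (by omega) hmod] at hb
  simp only [show q + 5 - 1 = q + 4 by omega, show q + 5 - 2 = q + 3 by omega,
    show q + 5 - 3 = q + 2 by omega, show q + 5 - 4 = q + 1 by omega,
    show q + 5 - 5 = q by omega] at h1 h2 h3
  rw [show 4 * (k + 1) - 1 = 4 * k + 3 by omega, show 4 * (k + 1) - 2 = 4 * k + 2 by omega,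
    show 4 * (k + 1) - 3 = 4 * k + 1 by omega, show 4 * (k + 1) - 4 = 4 * k by omega,
    show 2 * (k + 1) - 1 = 2 * k + 1 by omega, show 2 * (k + 1) - 2 = 2 * k by omega]
  zify at hb h1 h2 h3
  have hq : ((q : ℤ) + 5) ≠ 0 := by positivity
  replace h1 := mul_right_cancel₀ (pow_ne_zero 4 hq) (h1.trans (b := (_ : ℤ)) (c :=
    ((q + 5 : ℤ) ^ (4 * k) * ((q + 4) * (q + 3) * (q + 2) * (q + 1))) * (q + 5) ^ 4) (by ring))
  replace h2 := mul_right_cancel₀ (pow_ne_zero 2 hq) (h2.trans (b := (_ : ℤ)) (c :=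
    ((q + 5 : ℤ) ^ (2 * k) * ((q + 4) * (q + 1))) * (q + 5) ^ 2) (by ring))
  replace h3 := mul_right_cancel₀ (pow_ne_zero 2 hq) (h3.trans (b := (_ : ℤ)) (c :=
    ((q + 5 : ℤ) ^ (2 * k) * ((q + 2) * q)) * (q + 5) ^ 2) (by ring))
  rw [hb, h1, h2, h3]
  push_cast
  ring
end

section
/- For n = 5, any two matrices in 𝔉₅ are equivalent under the relation ~; that is, the equivalence relation ~ on 𝔉₅ has exactly one class. (Consequently, up to isomorphism there is only one Beauville surface with Beauville group ℤ₅², namely Beauville's original surface S_A^5 with A = [[1,3],[2,4]].) -/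
open Matrix

theorem M1_mem_Sgrp (n : ℕ) : M1 n ∈ Sgrp n :=
  Subgroup.subset_closure (Set.mem_insert _ _)

theorem M2_mem_Sgrp (n : ℕ) : M2 n ∈ Sgrp n :=
  Subgroup.subset_closure (Set.mem_insert_of_mem _ rfl)

theorem coe_M1 (n : ℕ) : (M1 n : Matrix (Fin 2) (Fin 2) (ZMod n)) = !![-1, 1; -1, 0] := rfl

theorem coe_M2 (n : ℕ) : (M2 n : Matrix (Fin 2) (Fin 2) (ZMod n)) = !![0, 1; 1, 0] := rfl

/-- A matrix in `𝔉ₙ` is invertible. -/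
theorem Frak.isUnit {n : ℕ} {A : Matrix (Fin 2) (Fin 2) (ZMod n)} (hA : Frak n A) :
    IsUnit A :=
  (Matrix.isUnit_iff_isUnit_det A).2 <| by
    rw [Matrix.det_fin_two]
    exact hA.1

theorem bRel_coe_iff {n : ℕ} {A B : GL (Fin 2) (ZMod n)} :
    BRel n A B ↔ ∃ P ∈ Sgrp n, ∃ Q ∈ Sgrp n, B = Q * A * P ∨ B = Q * A⁻¹ * P := by
  simp only [BRel, ← Matrix.coe_units_inv, ← Units.val_mul, Units.val_inj, exists_and_left]

theorem BRel.symm {n : ℕ} {A B : Matrix (Fin 2) (Fin 2) (ZMod n)} (hA : IsUnit A)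
    (hB : IsUnit B) (h : BRel n A B) : BRel n B A := by
  lift A to GL (Fin 2) (ZMod n) using hA
  lift B to GL (Fin 2) (ZMod n) using hB
  obtain ⟨P, hP, Q, hQ, rfl | rfl⟩ := bRel_coe_iff.1 h
  · exact bRel_coe_iff.2 ⟨P⁻¹, inv_mem hP, Q⁻¹, inv_mem hQ, .inl (by group)⟩
  · exact bRel_coe_iff.2 ⟨Q, hQ, P, hP, .inr (by group)⟩

theorem BRel.trans {n : ℕ} {A B C : Matrix (Fin 2) (Fin 2) (ZMod n)} (hA : IsUnit A)
    (hB : IsUnit B) (hC : IsUnit C) (hAB : BRel n A B) (hBC : BRel n B C) : BRel n A C := by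
  lift A to GL (Fin 2) (ZMod n) using hA
  lift B to GL (Fin 2) (ZMod n) using hB
  lift C to GL (Fin 2) (ZMod n) using hC
  obtain ⟨P, hP, Q, hQ, hAB⟩ := bRel_coe_iff.1 hAB
  obtain ⟨R, hR, T, hT, hBC⟩ := bRel_coe_iff.1 hBC
  rw [bRel_coe_iff]
  rcases hAB with rfl | rfl <;> rcases hBC with rfl | rfl
  · exact ⟨P * R, mul_mem hP hR, T * Q, mul_mem hT hQ, .inl (by group)⟩
  · exact ⟨Q⁻¹ * R, mul_mem (inv_mem hQ) hR, T * P⁻¹, mul_mem hT (inv_mem hP), .inr (by group)⟩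
  · exact ⟨P * R, mul_mem hP hR, T * Q, mul_mem hT hQ, .inr (by group)⟩
  · exact ⟨Q⁻¹ * R, mul_mem (inv_mem hQ) hR, T * P⁻¹, mul_mem hT (inv_mem hP), .inl (by group)⟩

theorem isUnit_zmod_five_iff {a : ZMod 5} : IsUnit a ↔ a ≠ 0 :=
  have : Fact (Nat.Prime 5) := ⟨Nat.prime_five⟩
  isUnit_iff_ne_zero

theorem frak_beauville : Frak 5 !![1, 3; 2, 4] := by
  simp only [Frak, isUnit_zmod_five_iff]
  decide

theorem inv_beauville : (!![1, 3; 2, 4] : Matrix (Fin 2) (Fin 2) (ZMod 5))⁻¹ = !![3, 4; 1, 2] :=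
  Matrix.inv_eq_right_inv (by decide)

/-- Every matrix in `𝔉₅` is obtained from Beauville's matrix or its inverse by multiplying on the
left by `M₁ ^ i * M₂ ^ j` and on the right by a power of `M₂`. -/
theorem exists_mul_beauville_mul_eq : ∀ a b c d : ZMod 5,
    a ≠ 0 → b ≠ 0 → c ≠ 0 → d ≠ 0 → a + b ≠ 0 → c + d ≠ 0 → a - c ≠ 0 → b - d ≠ 0 →
    a + b - c - d ≠ 0 → a * d - b * c ≠ 0 →
    ∃ (i : Fin 3) (j k : Fin 2),
      !![a, b; c, d] = !![-1, 1; -1, 0] ^ i.1 * !![0, 1; 1, 0] ^ j.1 * !![1, 3; 2, 4] *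
        !![0, 1; 1, 0] ^ k.1 ∨
      !![a, b; c, d] = !![-1, 1; -1, 0] ^ i.1 * !![0, 1; 1, 0] ^ j.1 * !![3, 4; 1, 2] *
        !![0, 1; 1, 0] ^ k.1 := by
  decide +kernel

/-- Every matrix in `𝔉₅` is equivalent to Beauville's matrix. -/
theorem bRel_beauville {A : Matrix (Fin 2) (Fin 2) (ZMod 5)} (hA : Frak 5 A) :
    BRel 5 !![1, 3; 2, 4] A := by
  simp only [Frak, isUnit_zmod_five_iff] at hA
  obtain ⟨h, ha, hb, hc, hd, hab, hcd, hac, hbd, habcd⟩ := hA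
  obtain ⟨i, j, k, hijk⟩ :=
    exists_mul_beauville_mul_eq _ _ _ _ ha hb hc hd hab hcd hac hbd habcd h
  refine ⟨M2 5 ^ k.1, M1 5 ^ i.1 * M2 5 ^ j.1, pow_mem (M2_mem_Sgrp 5) _,
    mul_mem (pow_mem (M1_mem_Sgrp 5) _) (pow_mem (M2_mem_Sgrp 5) _), ?_⟩
  rw [← Matrix.eta_fin_two A] at hijk
  simpa only [inv_beauville, Units.val_mul, Units.val_pow_eq_pow_val, coe_M1, coe_M2] using hijk

/-- Any two matrices in `𝔉₅` are equivalent under `~`, and `𝔉₅` contains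
Beauville's matrix `[[1,3],[2,4]]`; hence `~` has exactly one class on `𝔉₅` and, up to
isomorphism, there is only one Beauville surface with Beauville group `ℤ₅²`. -/
theorem frak_five_unique :
    (∀ A B : Matrix (Fin 2) (Fin 2) (ZMod 5), Frak 5 A → Frak 5 B → BRel 5 A B) ∧
    Frak 5 !![1, 3; 2, 4] ∧ Theta 5 = 1 := by
  have hrel : ∀ A B : Matrix (Fin 2) (Fin 2) (ZMod 5), Frak 5 A → Frak 5 B → BRel 5 A B :=
    fun A B hA hB => ((bRel_beauville hA).symm frak_beauville.isUnit hA.isUnit).trans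
      hA.isUnit frak_beauville.isUnit hB.isUnit (bRel_beauville hB)
  refine ⟨hrel, frak_beauville, Nat.card_eq_one_iff_unique.2 ⟨⟨?_⟩, ⟨Quot.mk _ ⟨_, frak_beauville⟩⟩⟩⟩
  rintro ⟨A⟩ ⟨B⟩
  exact Quot.sound (hrel A B A.2 B.2)
end

section
/- Let n ≥ 5 be coprime to 6 and let A ∈ 𝔉_n. Then the cardinality of the set {(P, Q, ε) ∈ S × S × {1, −1} : Q·A^ε·P⁻¹ = A} divides 6 (i.e. it is 1, 2, 3 or 6). -/
open Matrix

/-- The elements `x` of a subgroup `S` whose conjugate `g⁻¹ * x * g` lies in `S` as well. -/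
def conjInter {G : Type*} [Group G] (S : Subgroup G) (g : G) : Subgroup G :=
  S ⊓ S.comap (MulAut.conj g⁻¹).toMonoidHom

theorem mem_conjInter {G : Type*} [Group G] {S : Subgroup G} {g x : G} :
    x ∈ conjInter S g ↔ x ∈ S ∧ g⁻¹ * x * g ∈ S := by
  simp [conjInter, Subgroup.mem_inf]

/-- The stabilizer of `g` under `(p, q, ε) • g = q * g ^ ε * p⁻¹` has the order of
`conjInter S g` or twice that order, according to whether it has an element with `ε = -1`. -/
theorem card_stabilizer_eq_or {G : Type*} [Group G] (S : Subgroup G) (g : G) :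
    Nat.card {p : G × G × ℤˣ // p.1 ∈ S ∧ p.2.1 ∈ S ∧
      p.2.1 * (if p.2.2 = 1 then g else g⁻¹) * p.1⁻¹ = g} = Nat.card (conjInter S g) ∨
    Nat.card {p : G × G × ℤˣ // p.1 ∈ S ∧ p.2.1 ∈ S ∧
      p.2.1 * (if p.2.2 = 1 then g else g⁻¹) * p.1⁻¹ = g} = Nat.card (conjInter S g) * 2 := by
  have hne : (-1 : ℤˣ) ≠ 1 := by decide
  by_cases h : ∃ p₀ ∈ S, ∃ q₀ ∈ S, q₀ * g⁻¹ * p₀⁻¹ = g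
  · right
    obtain ⟨p₀, hp₀, q₀, hq₀, h₀⟩ := h
    have hcard : Nat.card (conjInter S g) * 2 = Nat.card (conjInter S g × ℤˣ) := by
      rw [Nat.card_prod, Nat.card_eq_fintype_card (α := ℤˣ), Fintype.card_units_int]
    rw [hcard]
    symm
    refine Nat.card_eq_of_bijective (fun x => ⟨if x.2 = 1 then (g⁻¹ * x.1 * g, x.1, 1)
      else (p₀ * x.1, q₀ * (g⁻¹ * x.1 * g), -1), ?_⟩) ⟨?_, ?_⟩
    · obtain ⟨⟨x, hx⟩, e⟩ := x
      rw [mem_conjInter] at hx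
      rcases Int.units_eq_one_or e with rfl | rfl
      · simp only [if_true]
        exact ⟨hx.2, hx.1, by group⟩
      · simp only [hne, if_false]
        refine ⟨S.mul_mem hp₀ hx.1, S.mul_mem hq₀ hx.2, Eq.trans ?_ h₀⟩
        group
    · rintro ⟨⟨x, hx⟩, e⟩ ⟨⟨y, hy⟩, f⟩ hxy
      rcases Int.units_eq_one_or e with rfl | rfl <;>
        rcases Int.units_eq_one_or f with rfl | rfl <;>
        simp_all
    · rintro ⟨⟨p, q, e⟩, hp, hq, h⟩
      dsimp only at hp hq h
      rcases Int.units_eq_one_or e with rfl | rfl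
      · rw [if_pos rfl, mul_inv_eq_iff_eq_mul] at h
        have hpq : g⁻¹ * q * g = p := by rw [mul_assoc, h]; group
        exact ⟨⟨⟨q, mem_conjInter.2 ⟨hq, hpq ▸ hp⟩⟩, 1⟩, by simp [hpq]⟩
      · rw [if_neg hne] at h
        have hpq : g⁻¹ * (p₀⁻¹ * p) * g = q₀⁻¹ * q := by
          have hg : q = g * p * g := by
            rw [mul_inv_eq_iff_eq_mul, mul_inv_eq_iff_eq_mul] at h
            exact h
          have hg₀ : q₀ = g * p₀ * g := by
            rw [mul_inv_eq_iff_eq_mul, mul_inv_eq_iff_eq_mul] at h₀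
            exact h₀
          rw [hg, hg₀]
          group
        refine ⟨⟨⟨p₀⁻¹ * p, mem_conjInter.2 ⟨S.mul_mem (S.inv_mem hp₀) hp, ?_⟩⟩, -1⟩, ?_⟩
        · rw [hpq]
          exact S.mul_mem (S.inv_mem hq₀) hq
        · simp [hne, hpq]
  · left
    symm
    refine Nat.card_eq_of_bijective (fun x => ⟨(g⁻¹ * x * g, x, 1), ?_⟩) ⟨?_, ?_⟩
    · have hx := mem_conjInter.1 x.2
      exact ⟨hx.2, hx.1, by rw [if_pos rfl]; group⟩
    · intro x y hxy
      simp only [Subtype.mk.injEq, Prod.mk.injEq] at hxy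
      exact Subtype.ext hxy.2.1
    · rintro ⟨⟨p, q, e⟩, hp, hq, h'⟩
      dsimp only at hp hq h'
      rcases Int.units_eq_one_or e with rfl | rfl
      · rw [if_pos rfl, mul_inv_eq_iff_eq_mul] at h'
        have hpq : g⁻¹ * q * g = p := by rw [mul_assoc, h']; group
        exact ⟨⟨q, mem_conjInter.2 ⟨hq, hpq ▸ hp⟩⟩, by simp [hpq]⟩
      · rw [if_neg hne] at h'
        exact absurd ⟨p, hp, q, hq, h'⟩ h

theorem M1_pow_three (n : ℕ) : M1 n ^ 3 = 1 := by
  ext i j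
  fin_cases i <;> fin_cases j <;> simp [pow_succ, coe_M1]

theorem M2_mul_self (n : ℕ) : M2 n * M2 n = 1 := by
  ext i j
  fin_cases i <;> fin_cases j <;> simp [coe_M2]

theorem M2_mul_M1_mul_M2 (n : ℕ) : M2 n * M1 n * M2 n = (M1 n)⁻¹ := by
  rw [eq_inv_iff_mul_eq_one]
  ext i j
  fin_cases i <;> fin_cases j <;> simp [coe_M1, coe_M2]

/-- Every element of `Sgrp n` is a power of `M1 n` or one of the three reflections. -/
theorem mem_Sgrp_cases {n : ℕ} {x : GL (Fin 2) (ZMod n)} (hx : x ∈ Sgrp n) :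
    (x = 1 ∨ x = M1 n ∨ x = M1 n * M1 n) ∨ x = M2 n ∨ x = M1 n * M2 n ∨ x = M2 n * M1 n := by
  have h3 : M1 n * (M1 n * M1 n) = 1 := by rw [← M1_pow_three n, pow_succ', pow_two]
  have h2 := M2_mul_self n
  have hi1 : (M1 n)⁻¹ = M1 n * M1 n := by rw [inv_eq_iff_mul_eq_one, h3]
  have hi2 : (M2 n)⁻¹ = M2 n := by rw [inv_eq_iff_mul_eq_one, h2]
  have hc : M1 n * (M1 n * M2 n) = M2 n * M1 n := by
    rw [← mul_assoc, ← hi1, ← M2_mul_M1_mul_M2, mul_assoc, h2, mul_one]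
  have hr : M1 n * (M2 n * M1 n) = M2 n := by
    rw [← hc, ← mul_assoc (M1 n) (M1 n) (M2 n), ← mul_assoc, h3, one_mul]
  have hs : M2 n * (M1 n * M1 n) = M1 n * M2 n := by
    rw [← mul_assoc, ← hc, mul_assoc, mul_assoc, hr]
  have hs' : M2 n * (M1 n * M2 n) = M1 n * M1 n := by
    rw [← mul_assoc, M2_mul_M1_mul_M2, hi1]
  have hs'' : M2 n * (M2 n * M1 n) = M1 n := by rw [← mul_assoc, h2, one_mul]
  have hmul1 : ∀ y, ((y = 1 ∨ y = M1 n ∨ y = M1 n * M1 n) ∨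
      y = M2 n ∨ y = M1 n * M2 n ∨ y = M2 n * M1 n) →
      (M1 n * y = 1 ∨ M1 n * y = M1 n ∨ M1 n * y = M1 n * M1 n) ∨
      M1 n * y = M2 n ∨ M1 n * y = M1 n * M2 n ∨ M1 n * y = M2 n * M1 n := by
    rintro y ((rfl | rfl | rfl) | rfl | rfl | rfl) <;>
      simp only [mul_one, h3, hc, hr, true_or, or_true]
  have hmul2 : ∀ y, ((y = 1 ∨ y = M1 n ∨ y = M1 n * M1 n) ∨
      y = M2 n ∨ y = M1 n * M2 n ∨ y = M2 n * M1 n) →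
      (M2 n * y = 1 ∨ M2 n * y = M1 n ∨ M2 n * y = M1 n * M1 n) ∨
      M2 n * y = M2 n ∨ M2 n * y = M1 n * M2 n ∨ M2 n * y = M2 n * M1 n := by
    rintro y ((rfl | rfl | rfl) | rfl | rfl | rfl) <;>
      simp only [mul_one, h2, hs, hs', hs'', true_or, or_true]
  induction hx using Subgroup.closure_induction_left with
  | one => exact Or.inl (Or.inl rfl)
  | mul_left z hz y _ ih =>
    rcases hz with rfl | rfl
    exacts [hmul1 y ih, hmul2 y ih]
  | inv_mul_cancel z hz y _ ih =>
    rcases hz with rfl | rfl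
    · rw [hi1, mul_assoc]
      exact hmul1 _ (hmul1 y ih)
    · rw [hi2]
      exact hmul2 y ih

/-- A matrix in `𝔉ₙ` intertwines no two reflections of `Sgrp n`. -/
theorem Frak.reflection_mul_ne {n : ℕ} [Nontrivial (ZMod n)] {g : GL (Fin 2) (ZMod n)}
    (hg : Frak n g) {x y : GL (Fin 2) (ZMod n)}
    (hx : x = M2 n ∨ x = M1 n * M2 n ∨ x = M2 n * M1 n)
    (hy : y = M2 n ∨ y = M1 n * M2 n ∨ y = M2 n * M1 n) : x * g ≠ g * y := by
  intro h
  have hm : ∀ i j, (x * g).val i j = (g * y).val i j := fun i j => by rw [h]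
  have h00 := hm 0 0
  have h01 := hm 0 1
  have h10 := hm 1 0
  have h11 := hm 1 1
  clear hm h
  obtain ⟨-, ha, hb, hc, hd, hab, hcd, hac, hbd, habcd⟩ := hg
  replace ha := ha.ne_zero
  replace hb := hb.ne_zero
  replace hc := hc.ne_zero
  replace hd := hd.ne_zero
  replace hab := hab.ne_zero
  replace hcd := hcd.ne_zero
  replace hac := hac.ne_zero
  replace hbd := hbd.ne_zero
  replace habcd := habcd.ne_zero
  rcases hx with rfl | rfl | rfl <;> rcases hy with rfl | rfl | rfl <;>
    simp [Matrix.mul_apply, Fin.sum_univ_two, coe_M1, coe_M2] at h00 h01 h10 h11 <;> grind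

theorem Frak.conjInter_le_zpowers {n : ℕ} [Nontrivial (ZMod n)] {g : GL (Fin 2) (ZMod n)}
    (hg : Frak n g) : conjInter (Sgrp n) g ≤ Subgroup.zpowers (M1 n) := by
  intro x hx
  obtain ⟨hx, hy⟩ := mem_conjInter.1 hx
  have hrot : ∀ z : GL (Fin 2) (ZMod n), z = 1 ∨ z = M1 n ∨ z = M1 n * M1 n →
      z ∈ Subgroup.zpowers (M1 n) := by
    have h1 := Subgroup.mem_zpowers (M1 n)
    rintro z (rfl | rfl | rfl)
    exacts [one_mem _, h1, mul_mem h1 h1]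
  rcases mem_Sgrp_cases hx with hx | hx
  · exact hrot x hx
  rcases mem_Sgrp_cases hy with hy | hy
  · have hx2 : x ^ 2 = 1 := by
      rcases hx with rfl | rfl | rfl <;> ext i j <;> fin_cases i <;> fin_cases j <;>
        simp [pow_two, coe_M1, coe_M2]
    have hx3 : x ^ 3 = 1 := by
      obtain ⟨k, hk⟩ := Subgroup.mem_zpowers_iff.1 (hrot _ hy)
      have hy3 : (g⁻¹ * x * g) ^ 3 = 1 := by
        rw [← hk, ← zpow_natCast, zpow_comm, zpow_natCast, M1_pow_three, _root_.one_zpow]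
      have hconj : x = g * (g⁻¹ * x * g) * g⁻¹ := by group
      rw [hconj, conj_pow, hy3, mul_one, mul_inv_cancel]
    rw [pow_succ, hx2, one_mul] at hx3
    exact hx3 ▸ one_mem _
  · exact absurd (by group) (hg.reflection_mul_ne hx hy)

/-- For `n ≥ 5` coprime to `6` and `A ∈ 𝔉ₙ`, the stabilizer
`{(P,Q,ε) ∈ S × S × {1,-1} : Q·A^ε·P⁻¹ = A}` has cardinality dividing `6`. -/
theorem stabilizer_card_dvd_six (n : ℕ) (hn : 5 ≤ n) (h6 : Nat.Coprime n 6)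
    (A : Matrix (Fin 2) (Fin 2) (ZMod n)) (hA : Frak n A) :
    Nat.card {PQe : GL (Fin 2) (ZMod n) × GL (Fin 2) (ZMod n) × ℤˣ //
        PQe.1 ∈ Sgrp n ∧ PQe.2.1 ∈ Sgrp n ∧
        (PQe.2.1 : Matrix (Fin 2) (Fin 2) (ZMod n)) * (if PQe.2.2 = 1 then A else A⁻¹) *
            ((PQe.1⁻¹ : GL (Fin 2) (ZMod n)) : Matrix (Fin 2) (Fin 2) (ZMod n)) = A} ∣ 6 := by
  have : Fact (1 < n) := ⟨by omega⟩
  obtain ⟨g, rfl⟩ : IsUnit A := by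
    rw [Matrix.isUnit_iff_isUnit_det, Matrix.det_fin_two]
    exact hA.1
  have hH : Nat.card (conjInter (Sgrp n) g) ∣ 3 :=
    (Subgroup.card_dvd_of_le hA.conjInter_le_zpowers).trans <| by
      rw [Nat.card_zpowers]
      exact orderOf_dvd_of_pow_eq_one (M1_pow_three n)
  have hval : ∀ (P Q : GL (Fin 2) (ZMod n)) (e : ℤˣ),
      (Q : Matrix (Fin 2) (Fin 2) (ZMod n)) *
        (if e = 1 then (g : Matrix (Fin 2) (Fin 2) (ZMod n)) else (g : Matrix _ _ _)⁻¹) *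
        ((P⁻¹ : GL (Fin 2) (ZMod n)) : Matrix (Fin 2) (Fin 2) (ZMod n)) = g ↔
      Q * (if e = 1 then g else g⁻¹) * P⁻¹ = g := by
    intro P Q e
    rw [← Matrix.coe_units_inv]
    split_ifs <;> rw [← Units.val_inj, Units.val_mul, Units.val_mul]
  simp only [hval]
  rcases card_stabilizer_eq_or (Sgrp n) g with h | h
  · rw [h]
    exact hH.trans (by norm_num)
  · rw [h]
    exact Nat.mul_dvd_mul hH (dvd_refl 2)
end

section
/- Let n ≥ 5 be coprime to 6 with 5 dividing n, and let A ∈ 𝔉_n. Then the cardinality of the set {(P, Q, ε) ∈ S × S × {1, −1} : Q·A^ε·P⁻¹ = A} divides 3 (i.e. it is 1 or 3). -/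
open Matrix

/-- The matrix `M₁ ^ i * M₂ ^ s` over an arbitrary commutative ring. -/
def symWord (R : Type*) [CommRing R] (i : Fin 3) (s : Fin 2) : Matrix (Fin 2) (Fin 2) R :=
  !![-1, 1; -1, 0] ^ i.val * !![0, 1; 1, 0] ^ s.val

theorem symWord_map {R S : Type*} [CommRing R] [CommRing S] (f : R →+* S) (i : Fin 3)
    (s : Fin 2) : f.mapMatrix (symWord R i s) = symWord S i s := by
  have h₁ : f.mapMatrix !![-1, 1; -1, 0] = !![-1, 1; -1, 0] := by
    ext a b; fin_cases a <;> fin_cases b <;> simp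
  have h₂ : f.mapMatrix !![0, 1; 1, 0] = !![0, 1; 1, 0] := by
    ext a b; fin_cases a <;> fin_cases b <;> simp
  rw [symWord, map_mul, map_pow, map_pow, h₁, h₂, symWord]

/-- No relation `Q = B * P * B` holds between `P, Q ∈ S₃`, and the relations `Q * B = B * P` only
occur between powers `P = M₁ ^ i` and `Q = M₁ ^ (j * i)`, for a `j` depending on `B`. -/
def OnlyRotations {R : Type*} [CommRing R] (B : Matrix (Fin 2) (Fin 2) R) : Prop :=
  ∃ j : Fin 3, ∀ (i k : Fin 3) (s t : Fin 2),
    (symWord R k t * B = B * symWord R i s → s = 0 ∧ t = 0 ∧ k = j * i) ∧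
    symWord R k t ≠ B * symWord R i s * B

instance {R : Type*} [CommRing R] [DecidableEq R] (B : Matrix (Fin 2) (Fin 2) R) :
    Decidable (OnlyRotations B) := by
  unfold OnlyRotations; infer_instance

set_option synthInstance.maxSize 1000 in
theorem onlyRotations_zmod_five : ∀ a b c d : ZMod 5, a * d - b * c ≠ 0 → a ≠ 0 → b ≠ 0 →
    c ≠ 0 → d ≠ 0 → a + b ≠ 0 → c + d ≠ 0 → a - c ≠ 0 → b - d ≠ 0 → a + b - c - d ≠ 0 →
    OnlyRotations !![a, b; c, d] := by
  decide +kernel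

theorem OnlyRotations.of_map {R S : Type*} [CommRing R] [CommRing S] (f : R →+* S)
    {B : Matrix (Fin 2) (Fin 2) R} (h : OnlyRotations (f.mapMatrix B)) : OnlyRotations B := by
  obtain ⟨j, hj⟩ := h
  refine ⟨j, fun i k s t => ⟨fun e => (hj i k s t).1 ?_, fun e => (hj i k s t).2 ?_⟩⟩
  · simpa only [map_mul, symWord_map] using congrArg f.mapMatrix e
  · simpa only [map_mul, symWord_map] using congrArg f.mapMatrix e

theorem Frak.onlyRotations {n : ℕ} (h5 : 5 ∣ n) {A : Matrix (Fin 2) (Fin 2) (ZMod n)}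
    (hA : Frak n A) : OnlyRotations A := by
  have : Fact (1 < 5) := ⟨by norm_num⟩
  have key {x : ZMod n} (hx : IsUnit x) : ZMod.castHom h5 (ZMod 5) x ≠ 0 :=
    (hx.map (ZMod.castHom h5 (ZMod 5))).ne_zero
  obtain ⟨h₀, h₁, h₂, h₃, h₄, h₅, h₆, h₇, h₈, h₉⟩ := hA
  apply OnlyRotations.of_map (ZMod.castHom h5 (ZMod 5))
  rw [Matrix.eta_fin_two ((ZMod.castHom h5 (ZMod 5)).mapMatrix A)]
  apply onlyRotations_zmod_five <;>
    simp only [RingHom.mapMatrix_apply, Matrix.map_apply, ← map_mul, ← map_add, ← map_sub] <;>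
    exact key ‹_›

theorem M2_sq (n : ℕ) : M2 n ^ 2 = 1 := by
  ext i j
  fin_cases i <;> fin_cases j <;>
    simp [M2, pow_succ, Matrix.nonsingInvUnit]

theorem semiconjBy_M2_M1 (n : ℕ) : SemiconjBy (M2 n) (M1 n) (M1 n ^ 2) := by
  ext i j
  fin_cases i <;> fin_cases j <;>
    simp [M1, M2, pow_succ, Matrix.nonsingInvUnit]

theorem exists_eq_pow_mul_pow_of_mem_Sgrp {n : ℕ} {g : GL (Fin 2) (ZMod n)} (hg : g ∈ Sgrp n) :
    ∃ (i : Fin 3) (s : Fin 2), g = M1 n ^ i.val * M2 n ^ s.val := by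
  suffices h : ∃ i s : ℕ, g = M1 n ^ i * M2 n ^ s by
    obtain ⟨i, s, rfl⟩ := h
    refine ⟨⟨i % 3, Nat.mod_lt _ (by norm_num)⟩, ⟨s % 2, Nat.mod_lt _ (by norm_num)⟩, ?_⟩
    rw [← pow_eq_pow_mod i (M1_pow_three n), ← pow_eq_pow_mod s (M2_sq n)]
  have left₁ (i s : ℕ) : M1 n * (M1 n ^ i * M2 n ^ s) = M1 n ^ (i + 1) * M2 n ^ s := by
    rw [← mul_assoc, ← pow_succ']
  have left₂ (i s : ℕ) : M2 n * (M1 n ^ i * M2 n ^ s) = M1 n ^ (2 * i) * M2 n ^ (s + 1) := by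
    rw [← mul_assoc, ((semiconjBy_M2_M1 n).pow_right i).eq, mul_assoc, ← pow_succ', ← pow_mul]
  have inv₁ : (M1 n)⁻¹ = M1 n * M1 n := by
    rw [inv_eq_iff_mul_eq_one, ← mul_assoc, ← pow_three', M1_pow_three]
  have inv₂ : (M2 n)⁻¹ = M2 n := by
    rw [inv_eq_iff_mul_eq_one, ← sq, M2_sq]
  induction hg using Subgroup.closure_induction_left with
  | one => exact ⟨0, 0, by simp⟩
  | mul_left x hx y _ ih =>
    obtain ⟨i, s, rfl⟩ := ih
    rcases hx with rfl | rfl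
    · exact ⟨_, _, left₁ i s⟩
    · exact ⟨_, _, left₂ i s⟩
  | inv_mul_cancel x hx y _ ih =>
    obtain ⟨i, s, rfl⟩ := ih
    rcases hx with rfl | rfl
    · exact ⟨i + 1 + 1, s, by rw [inv₁, mul_assoc, left₁, left₁]⟩
    · exact ⟨_, _, by rw [inv₂, left₂]⟩

theorem coe_pow_mul_pow (n : ℕ) (i : Fin 3) (s : Fin 2) :
    ((M1 n ^ i.val * M2 n ^ s.val : GL (Fin 2) (ZMod n)) : Matrix (Fin 2) (Fin 2) (ZMod n)) =
      symWord (ZMod n) i s :=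
  rfl

/-- The pairs `(P, Q) ∈ S × S` with `Q * A = A * P`. -/
def intertwiningPairs {R : Type*} [CommRing R] (S : Subgroup (GL (Fin 2) R))
    (A : Matrix (Fin 2) (Fin 2) R) : Subgroup (GL (Fin 2) R × GL (Fin 2) R) where
  carrier := {g | g.1 ∈ S ∧ g.2 ∈ S ∧
    (g.2 : Matrix (Fin 2) (Fin 2) R) * A = A * (g.1 : Matrix (Fin 2) (Fin 2) R)}
  one_mem' := ⟨S.one_mem, S.one_mem, by simp⟩
  mul_mem' := by
    rintro g h ⟨hg₁, hg₂, hg⟩ ⟨hh₁, hh₂, hh⟩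
    refine ⟨S.mul_mem hg₁ hh₁, S.mul_mem hg₂ hh₂, ?_⟩
    simp only [Prod.fst_mul, Prod.snd_mul, Units.val_mul]
    rw [mul_assoc, hh, ← mul_assoc, hg, mul_assoc]
  inv_mem' := by
    rintro g ⟨hg₁, hg₂, hg⟩
    refine ⟨S.inv_mem hg₁, S.inv_mem hg₂, ?_⟩
    rw [Prod.fst_inv, Prod.snd_inv, Units.inv_mul_eq_iff_eq_mul, ← mul_assoc, hg, mul_assoc,
      Units.mul_inv, mul_one]

theorem card_intertwiningPairs_dvd_three {n : ℕ} {A : Matrix (Fin 2) (Fin 2) (ZMod n)}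
    (hA : OnlyRotations A) : Nat.card (intertwiningPairs (Sgrp n) A) ∣ 3 := by
  obtain ⟨j, hj⟩ := hA
  have hle : intertwiningPairs (Sgrp n) A ≤ Subgroup.zpowers (M1 n, M1 n ^ j.val) := by
    rintro ⟨P, Q⟩ ⟨hP, hQ, h⟩
    obtain ⟨i, s, rfl⟩ := exists_eq_pow_mul_pow_of_mem_Sgrp hP
    obtain ⟨k, t, rfl⟩ := exists_eq_pow_mul_pow_of_mem_Sgrp hQ
    obtain ⟨rfl, rfl, rfl⟩ := (hj i k s t).1 h
    refine ⟨i.val, ?_⟩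
    simp [Fin.val_mul, ← pow_mul, ← pow_eq_pow_mod _ (M1_pow_three n)]
  refine (Subgroup.card_dvd_of_le hle).trans ?_
  rw [Nat.card_zpowers]
  apply orderOf_dvd_of_pow_eq_one
  rw [Prod.pow_mk, ← pow_mul, mul_comm, pow_mul, M1_pow_three, one_pow, Prod.mk_one_one]

/-- For `n ≥ 5` coprime to `6` with `5 ∣ n` and `A ∈ 𝔉ₙ`, the stabilizer
`{(P,Q,ε) ∈ S × S × {1,-1} : Q·A^ε·P⁻¹ = A}` has cardinality dividing `3`. -/
theorem stabilizer_card_dvd_three (n : ℕ) (hn : 5 ≤ n) (h6 : Nat.Coprime n 6) (h5 : 5 ∣ n)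
    (A : Matrix (Fin 2) (Fin 2) (ZMod n)) (hA : Frak n A) :
    Nat.card {PQe : GL (Fin 2) (ZMod n) × GL (Fin 2) (ZMod n) × ℤˣ //
        PQe.1 ∈ Sgrp n ∧ PQe.2.1 ∈ Sgrp n ∧
        (PQe.2.1 : Matrix (Fin 2) (Fin 2) (ZMod n)) * (if PQe.2.2 = 1 then A else A⁻¹) *
            ((PQe.1⁻¹ : GL (Fin 2) (ZMod n)) : Matrix (Fin 2) (Fin 2) (ZMod n)) = A} ∣ 3 := by
  have hrot := hA.onlyRotations h5
  have hdet : IsUnit A.det := by rw [Matrix.det_fin_two]; exact hA.1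
  convert card_intertwiningPairs_dvd_three hrot using 1
  have eps_eq_one {P Q : GL (Fin 2) (ZMod n)} {ε : ℤˣ} (hP : P ∈ Sgrp n) (hQ : Q ∈ Sgrp n)
      (h : (Q : Matrix (Fin 2) (Fin 2) (ZMod n)) * (if ε = 1 then A else A⁻¹) *
        ((P⁻¹ : GL (Fin 2) (ZMod n)) : Matrix (Fin 2) (Fin 2) (ZMod n)) = A) : ε = 1 := by
    by_contra hε
    rw [if_neg hε, Units.mul_inv_eq_iff_eq_mul] at h
    have hQA : (Q : Matrix (Fin 2) (Fin 2) (ZMod n)) = A * P * A := by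
      rw [← h, Matrix.nonsing_inv_mul_cancel_right _ _ hdet]
    obtain ⟨i, s, rfl⟩ := exists_eq_pow_mul_pow_of_mem_Sgrp hP
    obtain ⟨k, t, rfl⟩ := exists_eq_pow_mul_pow_of_mem_Sgrp hQ
    obtain ⟨j, hj⟩ := hrot
    exact (hj i k s t).2 hQA
  refine Nat.card_congr ⟨fun x => ⟨(x.1.1, x.1.2.1), ?_⟩, fun g => ⟨(g.1.1, g.1.2, 1), ?_⟩, ?_, ?_⟩
  · obtain ⟨⟨P, Q, ε⟩, hP, hQ, h⟩ := x
    obtain rfl := eps_eq_one hP hQ h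
    rw [if_pos rfl, Units.mul_inv_eq_iff_eq_mul] at h
    exact ⟨hP, hQ, h⟩
  · obtain ⟨⟨P, Q⟩, hP, hQ, h⟩ := g
    exact ⟨hP, hQ, by rwa [if_pos rfl, Units.mul_inv_eq_iff_eq_mul]⟩
  · rintro ⟨⟨P, Q, ε⟩, hP, hQ, h⟩
    obtain rfl := eps_eq_one hP hQ h
    rfl
  · rintro ⟨⟨P, Q⟩, h⟩
    rfl
end

section
/- Let n ≥ 1 with 5 dividing n. Then no matrix A ∈ 𝔉_n satisfies A·A = I, where I is the 2×2 identity matrix. -/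
open Matrix

/-- The entries of an involution over `ℤ/5ℤ` cannot all satisfy the conditions defining `𝔉₅`. -/
theorem involution_entries_zmod_five : ∀ a b c d : ZMod 5,
    a ≠ 0 → b ≠ 0 → c ≠ 0 → d ≠ 0 → a + b ≠ 0 → a - c ≠ 0 → a + b - c - d ≠ 0 →
    b * (a + d) = 0 → a * a + b * c ≠ 1 := by
  decide

/-- If `5 ∣ n` then `𝔉ₙ` contains no involution. -/
theorem no_involution_of_five_dvd (n : ℕ) (hn : 1 ≤ n) (h5 : 5 ∣ n) :
    ¬ ∃ A : Matrix (Fin 2) (Fin 2) (ZMod n), Frak n A ∧ A * A = 1 := by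
  rintro ⟨A, ⟨-, ha, hb, hc, hd, hab, -, hac, -, habcd⟩, hA⟩
  let f : ZMod n →+* ZMod 5 := ZMod.castHom h5 (ZMod 5)
  have : Fact (Nat.Prime 5) := ⟨by norm_num⟩
  have h00 : A 0 0 * A 0 0 + A 0 1 * A 1 0 = 1 := by
    simpa [Matrix.mul_apply] using congrFun (congrFun hA 0) 0
  have h01 : A 0 0 * A 0 1 + A 0 1 * A 1 1 = 0 := by
    simpa [Matrix.mul_apply] using congrFun (congrFun hA 0) 1
  have h01' : A 0 1 * (A 0 0 + A 1 1) = 0 := by linear_combination h01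
  refine involution_entries_zmod_five (f (A 0 0)) (f (A 0 1)) (f (A 1 0)) (f (A 1 1))
    (ha.map f).ne_zero (hb.map f).ne_zero (hc.map f).ne_zero (hd.map f).ne_zero ?_ ?_ ?_ ?_ ?_
  · simpa only [map_add] using (hab.map f).ne_zero
  · simpa only [map_sub] using (hac.map f).ne_zero
  · simpa only [map_add, map_sub] using (habcd.map f).ne_zero
  · simpa only [map_mul, map_add, map_zero] using congrArg f h01'
  · simpa only [map_mul, map_add, map_one] using congrArg f h00
end

section
/- Let p ≥ 5 be a prime and e ≥ 1, and set n = p^e. Then 625·|𝔉_n| ≥ 24·n⁴; equivalently, |𝔉_n|/n⁴ ≥ 4!/5⁴. -/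
open Matrix

/-- Translates of the nonunits by the elements of `S` remove at most `#S` times the number of
nonunits from a finite ring. -/
theorem card_le_card_filter_isUnit_sub_add {R : Type*} [CommRing R] [Fintype R]
    [DecidablePred (IsUnit : R → Prop)] (S : Finset R) :
    Fintype.card R ≤ (Finset.univ.filter fun x : R => ∀ s ∈ S, IsUnit (x - s)).card +
      S.card * (Finset.univ.filter fun x : R => ¬ IsUnit x).card := by
  classical
  have hcover : (Finset.univ : Finset R) ⊆
      (Finset.univ.filter fun x : R => ∀ s ∈ S, IsUnit (x - s)) ∪
        S.biUnion fun s => (Finset.univ.filter fun x : R => ¬ IsUnit x).image (· + s) := by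
    intro x _
    by_cases hx : ∀ s ∈ S, IsUnit (x - s)
    · exact Finset.mem_union_left _ (by simpa using hx)
    · push Not at hx
      obtain ⟨s, hs, hxs⟩ := hx
      refine Finset.mem_union_right _ (Finset.mem_biUnion.2 ⟨s, hs, Finset.mem_image.2 ?_⟩)
      exact ⟨x - s, by simpa using hxs, sub_add_cancel x s⟩
  calc Fintype.card R = (Finset.univ : Finset R).card := rfl
    _ ≤ _ := Finset.card_le_card hcover
    _ ≤ _ := Finset.card_union_le _ _
    _ ≤ _ := by
      gcongr
      exact Finset.card_biUnion_le_card_mul _ _ _ fun s _ => Finset.card_image_le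

theorem ZMod.card_filter_not_isUnit_prime_pow_succ {p : ℕ} (hp : p.Prime) (k : ℕ)
    [Fintype (ZMod (p ^ (k + 1)))] [DecidablePred (IsUnit : ZMod (p ^ (k + 1)) → Prop)] :
    (Finset.univ.filter fun x : ZMod (p ^ (k + 1)) => ¬ IsUnit x).card = p ^ k := by
  have : NeZero (p ^ (k + 1)) := ⟨pow_ne_zero _ hp.ne_zero⟩
  have hunits : (Finset.univ.filter fun x : ZMod (p ^ (k + 1)) => IsUnit x).card =
      p ^ k * (p - 1) := by
    rw [← Nat.totient_prime_pow_succ hp, ← ZMod.card_units_eq_totient, ← Finset.card_univ]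
    symm
    refine Finset.card_bij (fun u _ => (u : ZMod (p ^ (k + 1)))) ?_ ?_ ?_
    · intro u _
      simp
    · intro u _ v _ h
      exact Units.ext h
    · intro x hx
      obtain ⟨u, rfl⟩ := (Finset.mem_filter.1 hx).2
      exact ⟨u, Finset.mem_univ _, rfl⟩
  have hsum := Finset.card_filter_add_card_filter_not
    (s := (Finset.univ : Finset (ZMod (p ^ (k + 1))))) (fun x => IsUnit x)
  rw [hunits, Finset.card_univ, ← Nat.card_eq_fintype_card, Nat.card_zmod] at hsum
  have hpos : p ^ k * (p - 1) + p ^ k = p ^ (k + 1) := by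
    rw [← Nat.mul_succ, Nat.succ_eq_add_one, Nat.sub_add_cancel hp.one_le, pow_succ]
  omega

theorem ZMod.mul_le_card_filter_isUnit_sub {p : ℕ} (hp : p.Prime) (k : ℕ)
    [Fintype (ZMod (p ^ (k + 1)))] [DecidablePred (IsUnit : ZMod (p ^ (k + 1)) → Prop)]
    {r : ℕ} {S : Finset (ZMod (p ^ (k + 1)))} (hS : S.card ≤ r) :
    (p - r) * p ^ k ≤
      (Finset.univ.filter fun x : ZMod (p ^ (k + 1)) => ∀ s ∈ S, IsUnit (x - s)).card := by
  rw [Nat.sub_mul, tsub_le_iff_right]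
  calc p * p ^ k = Fintype.card (ZMod (p ^ (k + 1))) := by
        rw [← Nat.card_eq_fintype_card, Nat.card_zmod, pow_succ']
    _ ≤ (Finset.univ.filter fun x : ZMod (p ^ (k + 1)) => ∀ s ∈ S, IsUnit (x - s)).card +
        S.card * p ^ k := by
      convert card_le_card_filter_isUnit_sub_add S
      exact (ZMod.card_filter_not_isUnit_prime_pow_succ hp k).symm
    _ ≤ _ := by gcongr

theorem Finset.mul_le_card_sigma {α : Type*} {β : α → Type*} {s : Finset α}
    {t : ∀ a, Finset (β a)} {M N : ℕ} (hs : M ≤ s.card) (ht : ∀ a ∈ s, N ≤ (t a).card) :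
    M * N ≤ (s.sigma t).card := by
  rw [Finset.card_sigma]
  calc M * N ≤ s.card * N := Nat.mul_le_mul_right N hs
    _ ≤ _ := by simpa using Finset.card_nsmul_le_sum s _ N ht

theorem frak_of_isUnit {n : ℕ} {a x y t : ZMod n} (ha : IsUnit a)
    (hx : IsUnit x) (hx1 : IsUnit (x + 1)) (hy : IsUnit y) (hy1 : IsUnit (y + 1))
    (hyx : IsUnit (y - x)) (ht : IsUnit t) (ht1 : IsUnit (t - 1))
    (hty : IsUnit (t - x * Ring.inverse y))
    (hty1 : IsUnit (t - (x + 1) * Ring.inverse (y + 1))) :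
    Frak n !![a, a * x; t * a, t * a * y] := by
  have ey := Ring.mul_inverse_cancel y hy
  have ey1 := Ring.mul_inverse_cancel (y + 1) hy1
  simp only [Frak, Matrix.of_apply, Matrix.cons_val', Matrix.cons_val_zero, Matrix.cons_val_one,
    Matrix.cons_val_fin_one]
  refine ⟨?_, ha, ha.mul hx, ht.mul ha, (ht.mul ha).mul hy, ?_, ?_, ?_, ?_, ?_⟩
  · convert ((ha.mul ha).mul ht).mul hyx using 1
    ring
  · convert ha.mul hx1 using 1
    ring
  · convert (ht.mul ha).mul hy1 using 1
    ring
  · convert (ha.mul ht1).neg using 1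
    ring
  · convert ((ha.mul hy).mul hty).neg using 1
    linear_combination -(a * x) * ey
  · convert ((ha.mul hy1).mul hty1).neg using 1
    linear_combination -(a * (x + 1)) * ey1

theorem prod_mul_pow_le_card_frak {p : ℕ} (hp : p.Prime) (k : ℕ) :
    (p - 1) * p ^ k * ((p - 2) * p ^ k) * ((p - 3) * p ^ k) * ((p - 4) * p ^ k) ≤
      Nat.card {A : Matrix (Fin 2) (Fin 2) (ZMod (p ^ (k + 1))) //
        Frak (p ^ (k + 1)) A} := by
  classical
  have : NeZero (p ^ (k + 1)) := ⟨pow_ne_zero _ hp.ne_zero⟩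
  let R := ZMod (p ^ (k + 1))
  let U : Finset R → Finset R := fun S => Finset.univ.filter fun x => ∀ s ∈ S, IsUnit (x - s)
  let P : Finset (Σ _ : Σ _ : Σ _ : R, R, R, R) :=
    (((U {0}).sigma fun _ => U {0, -1}).sigma fun w => U {0, -1, w.2}).sigma fun w =>
      U {0, 1, w.1.2 * Ring.inverse w.2, (w.1.2 + 1) * Ring.inverse (w.2 + 1)}
  have hU : ∀ {r : ℕ} {S : Finset R}, S.card ≤ r → (p - r) * p ^ k ≤ (U S).card :=
    fun hS => ZMod.mul_le_card_filter_isUnit_sub hp k hS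
  have hP : (p - 1) * p ^ k * ((p - 2) * p ^ k) * ((p - 3) * p ^ k) * ((p - 4) * p ^ k) ≤
      P.card :=
    Finset.mul_le_card_sigma (Finset.mul_le_card_sigma (Finset.mul_le_card_sigma
      (hU (Finset.card_singleton _).le) fun _ _ => hU Finset.card_le_two)
      fun _ _ => hU Finset.card_le_three) fun _ _ => hU Finset.card_le_four
  refine hP.trans ?_
  rw [Nat.card_eq_fintype_card, Fintype.card_subtype]
  refine Finset.card_le_card_of_injOn
    (fun w => !![w.1.1.1, w.1.1.1 * w.1.1.2; w.2 * w.1.1.1, w.2 * w.1.1.1 * w.1.2]) ?_ ?_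
  · rintro ⟨⟨⟨a, x⟩, y⟩, t⟩ hw
    simp only [P, U, Finset.coe_sigma, Set.mem_sigma_iff, Finset.coe_filter, Set.mem_ofPred_eq,
      Finset.mem_univ, true_and, Finset.mem_insert, Finset.mem_singleton, forall_eq_or_imp,
      forall_eq, sub_zero, sub_neg_eq_add] at hw
    obtain ⟨⟨⟨ha, hx, hx1⟩, hy, hy1, hyx⟩, ht, ht1, hty, hty1⟩ := hw
    simpa using frak_of_isUnit ha hx hx1 hy hy1 hyx ht ht1 hty hty1
  · rintro ⟨⟨⟨a, x⟩, y⟩, t⟩ hw ⟨⟨⟨a', x'⟩, y'⟩, t'⟩ _ h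
    simp only [P, U, Finset.coe_sigma, Set.mem_sigma_iff, Finset.coe_filter, Set.mem_ofPred_eq,
      Finset.mem_univ, true_and, Finset.mem_insert, Finset.mem_singleton, forall_eq_or_imp,
      forall_eq, sub_zero, sub_neg_eq_add] at hw
    obtain ⟨⟨⟨ha, -⟩, -⟩, ht, -⟩ := hw
    have h00 := congrFun (congrFun h 0) 0
    have h01 := congrFun (congrFun h 0) 1
    have h10 := congrFun (congrFun h 1) 0
    have h11 := congrFun (congrFun h 1) 1
    simp only [Matrix.of_apply, Matrix.cons_val', Matrix.cons_val_zero, Matrix.cons_val_one,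
      Matrix.cons_val_fin_one] at h00 h01 h10 h11
    subst h00
    obtain rfl := ha.mul_left_cancel h01
    obtain rfl := ha.mul_right_cancel h10
    obtain rfl := (ht.mul ha).mul_left_cancel h11
    rfl

/-- For `n = p^e` with `p ≥ 5` prime, `625·|𝔉ₙ| ≥ 24·n⁴`,
i.e. `|𝔉ₙ|/n⁴ ≥ 4!/5⁴`. -/
theorem card_Frak_lower_bound (p : ℕ) (hp : p.Prime) (hp5 : 5 ≤ p) (e : ℕ) (he : 1 ≤ e)
    (n : ℕ) (hn : n = p ^ e) :
    625 * Nat.card {A : Matrix (Fin 2) (Fin 2) (ZMod n) // Frak n A} ≥ 24 * n ^ 4 := by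
  subst hn
  obtain ⟨k, rfl⟩ : ∃ k, e = k + 1 := ⟨e - 1, by omega⟩
  have hcard := Nat.mul_le_mul_left 625 (prod_mul_pow_le_card_frak hp k)
  refine le_trans ?_ hcard
  obtain ⟨m, rfl⟩ : ∃ m, p = m + 5 := ⟨p - 5, by omega⟩
  simp only [Nat.reduceSubDiff, pow_succ (m + 5) k]
  generalize (m + 5) ^ k = q
  have hpoly : 24 * (m + 5) ^ 4 ≤ 625 * ((m + 4) * (m + 3) * (m + 2) * (m + 1)) := by
    ring_nf
    omega
  calc 24 * (q * (m + 5)) ^ 4 = 24 * (m + 5) ^ 4 * q ^ 4 := by ring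
    _ ≤ 625 * ((m + 4) * (m + 3) * (m + 2) * (m + 1)) * q ^ 4 := Nat.mul_le_mul_right _ hpoly
    _ = _ := by ring
end
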